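/- arXiv:2111.04596 — 2 statements merged into one kernel-verified Lean document; each statement's English description precedes it below -/
import Mathlib

section
/- Let J : ℝ^P → ℝ be a twice continuously differentiable, coercive Morse function (coercive: J(θ) → +∞ as ‖θ‖ → ∞), and let α ≥ 0, β > 0. Then: (i) for every initial condition, the corresponding solution of the DIN system converges as t → ∞; (ii) if (θ₀, ψ₀) is a random variable on ℝ^P × ℝ^P whose law is absolutely continuous with respect to Lebesgue measure, and (θ*, ψ*) denotes the limit of the solution of DIN initialized at (θ₀, ψ₀), then with probability one θ* is a local minimizer of J. -/
open Filter MeasureTheory Topology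

/-- `(θ, ψ)` is a solution of the DIN system
`θ' = −(α − 1/β)θ − (1/β)ψ − β∇J(θ)`, `ψ' = −(α − 1/β)θ − (1/β)ψ`,
continuously differentiable on `[0, ∞)`. -/
def IsDINSolution {P : ℕ} (J : EuclideanSpace ℝ (Fin P) → ℝ) (α β : ℝ)
    (θ ψ : ℝ → EuclideanSpace ℝ (Fin P)) : Prop :=
  ContinuousOn θ (Set.Ici 0) ∧ ContinuousOn ψ (Set.Ici 0) ∧
  (∀ t > (0 : ℝ),
    HasDerivAt θ (-(α - 1 / β) • θ t - (1 / β) • ψ t - β • gradient J (θ t)) t) ∧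
  (∀ t > (0 : ℝ), HasDerivAt ψ (-(α - 1 / β) • θ t - (1 / β) • ψ t) t)

/-- A subset of a finite-dimensional space which embeds, with Lipschitz inverse, into a space of
smaller dimension is null. -/
lemma volume_eq_zero_of_dist_le {V W : Type*} [NormedAddCommGroup V] [NormedSpace ℝ V]
    [FiniteDimensional ℝ V] [MeasurableSpace V] [BorelSpace V]
    [NormedAddCommGroup W] [NormedSpace ℝ W] [FiniteDimensional ℝ W]
    (hlt : Module.finrank ℝ W < Module.finrank ℝ V) (μ : Measure V) [μ.IsAddHaarMeasure]
    (s : Set V) (f : V → W) (C : ℝ) (hC : 0 ≤ C)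
    (hf : ∀ p ∈ s, ∀ q ∈ s, dist p q ≤ C * dist (f p) (f q)) : μ s = 0 := by
  have hanti : AntilipschitzWith ⟨C, hC⟩ (s.domRestrict f) :=
    AntilipschitzWith.of_le_mul_dist fun p q => hf p p.2 q q.2
  have hdim : dimH s ≤ Module.finrank ℝ W := by
    have h := isometry_subtype_coe.dimH_image (Set.univ : Set s)
    rw [Set.image_univ, Subtype.range_coe] at h
    rw [h, ← Real.dimH_univ_eq_finrank W]
    exact (hanti.le_dimH_image _).trans (dimH_mono (Set.subset_univ _))
  refine measure_zero_of_dimH_lt (d := Module.finrank ℝ V) ?_ ?_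
  · simpa using Measure.absolutelyContinuous_isAddHaarMeasure μ
      (Measure.hausdorffMeasure (Module.finrank ℝ V))
  · exact hdim.trans_lt (by exact_mod_cast hlt)

/-- Barbalat's lemma along a bounded trajectory of an autonomous system: if `f' = G ∘ x` and `f`
converges, then `G ∘ x` tends to zero. -/
lemma tendsto_zero_of_hasDerivAt_comp {V W : Type*} [NormedAddCommGroup V] [NormedSpace ℝ V]
    [ProperSpace V] [NormedAddCommGroup W] [NormedSpace ℝ W]
    {x : ℝ → V} {F : V → V} (hF : Continuous F) (hx : ∀ t > 0, HasDerivAt x (F (x t)) t)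
    {R : ℝ} (hR : ∀ t > 0, ‖x t‖ ≤ R) {G : V → W} (hG : Continuous G) {f : ℝ → W}
    (hf : ∀ t > 0, HasDerivAt f (G (x t)) t) {l : W} (hl : Tendsto f atTop (𝓝 l)) :
    Tendsto (fun t => G (x t)) atTop (𝓝 0) := by
  have hK := isCompact_closedBall (0 : V) R
  have hmem : ∀ t > 0, x t ∈ Metric.closedBall (0 : V) R := fun t ht => by simpa using hR t ht
  obtain ⟨M, hM⟩ := hK.exists_bound_of_continuousOn hF.continuousOn
  have hM0 : 0 ≤ M := (norm_nonneg _).trans (hM _ (hmem 1 one_pos))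
  have hlip : ∀ s > 0, ∀ t > 0, ‖x s - x t‖ ≤ M * ‖s - t‖ := fun s hs t ht =>
    (convex_Ioi (0 : ℝ)).norm_image_sub_le_of_norm_hasDerivWithin_le
      (fun u hu => (hx u hu).hasDerivWithinAt) (fun u hu => hM _ (hmem u hu)) ht hs
  have huc := Metric.uniformContinuousOn_iff_le.1
    (hK.uniformContinuousOn_of_continuous hG.continuousOn)
  refine Metric.tendsto_atTop'.2 fun ε hε => ?_
  obtain ⟨δ, hδ, hδG⟩ := huc (ε / 3) (by positivity)
  set h := δ / (M + 1) with hh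
  have hhpos : 0 < h := by positivity
  have hMh : M * h ≤ δ := by
    rw [hh, mul_div_assoc', div_le_iff₀ (by positivity)]; nlinarith
  obtain ⟨N, hN⟩ := Metric.tendsto_atTop'.1 hl (ε * h / 6) (by positivity)
  refine ⟨max N 0, fun t ht => ?_⟩
  have ht0 : 0 < t := (le_max_right _ _).trans_lt ht
  have htN : N < t := (le_max_left _ _).trans_lt ht
  have key : ‖(f (t + h) - (t + h) • G (x t)) - (f t - t • G (x t))‖ ≤ ε / 3 * ‖(t + h) - t‖ := by
    refine (convex_Icc t (t + h)).norm_image_sub_le_of_norm_hasDerivWithin_le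
      (f := fun s => f s - s • G (x t)) (f' := fun s => G (x s) - G (x t))
      (fun s hs => ?_) (fun s hs => ?_) ⟨le_rfl, by linarith⟩ ⟨by linarith, le_rfl⟩
    · have := (hf s (ht0.trans_le hs.1)).sub ((hasDerivAt_id s).smul_const (G (x t)))
      rw [one_smul] at this
      exact this.hasDerivWithinAt
    · have hs0 := ht0.trans_le hs.1
      rw [← dist_eq_norm]
      refine hδG _ (hmem s hs0) _ (hmem t ht0) ?_
      rw [dist_eq_norm]
      refine (hlip s hs0 t ht0).trans (le_trans ?_ hMh)
      gcongr
      rw [Real.norm_eq_abs, abs_of_nonneg (by linarith [hs.1])]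
      linarith [hs.2]
  have e1 := hN t htN
  have e2 := hN (t + h) (by linarith)
  have e3 : h * ‖G (x t)‖ ≤ ‖f (t + h) - f t‖ + ε / 3 * h := by
    have : h • G (x t) = (f (t + h) - f t) -
        ((f (t + h) - (t + h) • G (x t)) - (f t - t • G (x t))) := by module
    rw [add_sub_cancel_left, Real.norm_eq_abs, abs_of_pos hhpos] at key
    have hn : h * ‖G (x t)‖ = ‖h • G (x t)‖ := by
      rw [norm_smul, Real.norm_eq_abs, abs_of_pos hhpos]
    rw [hn, this]
    exact (norm_sub_le _ _).trans (by gcongr)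
  have e4 : ‖f (t + h) - f t‖ ≤ ε * h / 3 := by
    rw [← dist_eq_norm]
    linarith [dist_triangle_right (f (t + h)) (f t) l]
  rw [dist_zero_right]
  have : h * ‖G (x t)‖ < h * ε := by nlinarith
  exact lt_of_mul_lt_mul_left this hhpos.le

/-- A bounded continuous curve along which `g` tends to zero converges to a zero of `g`, provided
the zeros of `g` are isolated. -/
lemma exists_tendsto_of_isolated_zeros {V W : Type*} [NormedAddCommGroup V]
    [ProperSpace V] [NormedAddCommGroup W] {x : ℝ → V}
    (hx : ContinuousOn x (Set.Ici 0)) {R : ℝ} (hR : ∀ t ≥ 0, ‖x t‖ ≤ R) {g : V → W}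
    (hg : Continuous g) (hiso : ∀ q, g q = 0 → ∀ᶠ y in 𝓝[≠] q, g y ≠ 0)
    (hlim : Tendsto (fun t => g (x t)) atTop (𝓝 0)) :
    ∃ q, g q = 0 ∧ Tendsto x atTop (𝓝 q) := by
  have hzero : ∀ q, MapClusterPt q atTop x → g q = 0 := by
    intro q hq
    have h1 : MapClusterPt (g q) atTop (g ∘ x) := hq.continuousAt_comp hg.continuousAt
    exact eq_of_nhds_neBot (ClusterPt.mono h1 hlim)
  obtain ⟨q, -, hq⟩ := (isCompact_closedBall (0 : V) R).exists_mapClusterPt_of_frequently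
    (f := x) (l := atTop)
    ((eventually_ge_atTop (0 : ℝ)).mono fun t ht => by simpa using hR t ht).frequently
  refine ⟨q, hzero q hq, ?_⟩
  obtain ⟨r, hr, hball⟩ := Metric.eventually_nhds_iff.1
    (eventually_nhdsWithin_iff.1 (hiso q (hzero q hq)))
  refine Metric.tendsto_nhds.2 fun ε hε => ?_
  set ρ := min (r / 2) (ε / 2)
  have hρ : 0 < ρ := by positivity
  have hsphere : ∀ᶠ t in atTop, x t ∉ Metric.sphere q ρ := by
    by_contra hcon
    obtain ⟨p, hp, hpc⟩ := (isCompact_sphere q ρ).exists_mapClusterPt_of_frequently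
      (f := x) (l := atTop) (by simpa [Filter.Frequently] using hcon)
    rw [Metric.mem_sphere] at hp
    refine hball (y := p) ?_ ?_ (hzero p hpc)
    · rw [hp]; exact (min_le_left _ _).trans_lt (by linarith)
    · rintro rfl
      rw [dist_self] at hp
      linarith
  obtain ⟨T, hT⟩ := eventually_atTop.1 hsphere
  obtain ⟨t₀, ht₀, hxt₀⟩ := frequently_atTop.1
    (hq.frequently (Metric.ball_mem_nhds q hρ)) (max T 0)
  filter_upwards [eventually_ge_atTop t₀] with t ht
  have hlt : dist (x t) q < ρ := by
    by_contra! hge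
    have hcont : ContinuousOn (fun s => dist (x s) q) (Set.Icc t₀ t) :=
      (continuous_id.dist continuous_const).comp_continuousOn
        (hx.mono fun s hs => ((le_max_right _ _).trans ht₀).trans hs.1)
    obtain ⟨s, hs, hsρ⟩ := intermediate_value_Icc ht hcont ⟨(Metric.mem_ball.1 hxt₀).le, hge⟩
    exact hT s (((le_max_left _ _).trans ht₀).trans hs.1) hsρ
  exact hlt.trans_le ((min_le_right _ _).trans (by linarith))

/-- Backward Lipschitz dependence on the final value for trajectories confined to a set on which
the vector field is Lipschitz. -/
lemma dist_zero_le_of_trajectories {V : Type*} [NormedAddCommGroup V] [NormedSpace ℝ V]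
    {F : V → V} {s : Set V} {K : NNReal} (hF : LipschitzOnWith K F s) {N : ℝ} (hN : 0 ≤ N)
    {x y : ℝ → V} (hx : ContinuousOn x (Set.Ici 0)) (hx' : ∀ t > 0, HasDerivAt x (F (x t)) t)
    (hxs : ∀ t ∈ Set.Icc 0 N, x t ∈ s)
    (hy : ContinuousOn y (Set.Ici 0)) (hy' : ∀ t > 0, HasDerivAt y (F (y t)) t)
    (hys : ∀ t ∈ Set.Icc 0 N, y t ∈ s) :
    dist (x 0) (y 0) ≤ Real.exp (K * N) * dist (x N) (y N) := by
  have hcont : ∀ {z : ℝ → V}, ContinuousOn z (Set.Ici 0) →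
      ContinuousOn (fun t => z (N - t)) (Set.Icc 0 N) := fun hz =>
    hz.comp (by fun_prop) fun t ht => by simpa using ht.2
  have hder : ∀ {z : ℝ → V}, (∀ t > 0, HasDerivAt z (F (z t)) t) → ∀ t ∈ Set.Ico 0 N,
      HasDerivWithinAt (fun t => z (N - t)) (-F (z (N - t))) (Set.Ici t) t := fun hz t ht =>
    (HasDerivAt.comp_const_sub N t (hz (N - t) (by linarith [ht.2]))).hasDerivWithinAt
  have hmem : ∀ {t}, t ∈ Set.Ico 0 N → N - t ∈ Set.Icc 0 N := fun ht =>
    ⟨by linarith [ht.2], by linarith [ht.1]⟩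
  have := dist_le_of_trajectories_ODE_of_mem (v := fun _ z => -F z) (s := fun _ => s) (K := K)
    (δ := dist (x N) (y N)) (a := 0) (b := N) (fun _ _ => hF.neg) (hcont hx) (hder hx')
    (fun t ht => hxs _ (hmem ht)) (hcont hy) (hder hy') (fun t ht => hys _ (hmem ht))
    (by simp) N ⟨hN, le_rfl⟩
  simpa [mul_comm] using this

/-- If a continuous quadratic function is positive on a nonzero vector, then on its nonpositive set
the norm is controlled by a linear map of corank one. -/
lemma exists_norm_le_of_quadratic {V : Type*} [NormedAddCommGroup V] [NormedSpace ℝ V]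
    [FiniteDimensional ℝ V] {Q : V → ℝ} (hQ : Continuous Q)
    (hsmul : ∀ (c : ℝ) z, Q (c • z) = c ^ 2 * Q z) {e : V} (he : 0 < Q e) :
    ∃ (π : V →ₗ[ℝ] (Fin (Module.finrank ℝ V - 1) → ℝ)) (C : ℝ), 0 ≤ C ∧
      ∀ z, Q z ≤ 0 → ‖z‖ ≤ C * ‖π z‖ := by
  have he0 : e ≠ 0 := by
    rintro rfl
    have := hsmul 0 0
    rw [smul_zero] at this
    linarith
  have hfin : Module.finrank ℝ (V ⧸ Submodule.span ℝ {e}) =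
      Module.finrank ℝ (Fin (Module.finrank ℝ V - 1) → ℝ) := by
    have := Submodule.finrank_quotient_add_finrank (Submodule.span ℝ {e})
    rw [finrank_span_singleton he0] at this
    rw [Module.finrank_fin_fun]
    omega
  set π := (LinearEquiv.ofFinrankEq _ _ hfin).toLinearMap ∘ₗ (Submodule.span ℝ {e}).mkQ with hπ
  have hker : ∀ z, π z = 0 → z ∈ Submodule.span ℝ {e} := fun z hz => by simpa [hπ] using hz
  have hK : IsCompact (Metric.sphere (0 : V) 1 ∩ {z | Q z ≤ 0}) :=
    (isCompact_sphere 0 1).inter_right (isClosed_le hQ continuous_const)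
  obtain ⟨m, hm, hmK⟩ := hK.exists_forall_le' (f := fun z => ‖π z‖)
    π.continuous_of_finiteDimensional.norm.continuousOn (a := 0) (by
    rintro z ⟨hz1, hz2⟩
    rw [norm_pos_iff]
    intro h0
    obtain ⟨c, rfl⟩ := Submodule.mem_span_singleton.1 (hker z h0)
    have hc : c ≠ 0 := by rintro rfl; simp at hz1
    rw [Set.mem_ofPred_eq, hsmul] at hz2
    have : 0 < c ^ 2 * Q e := by positivity
    linarith)
  refine ⟨π, m⁻¹, by positivity, fun z hz => ?_⟩
  rcases eq_or_ne z 0 with rfl | hz0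
  · simp
  have hzn : 0 < ‖z‖ := norm_pos_iff.2 hz0
  have := hmK (‖z‖⁻¹ • z) ⟨by simp [norm_smul, hzn.ne'], by
    rw [Set.mem_ofPred_eq, hsmul]; exact mul_nonpos_of_nonneg_of_nonpos (by positivity) hz⟩
  simp only [map_smul, norm_smul, norm_inv, norm_norm] at this
  rw [inv_mul_eq_div, le_div_iff₀ hzn] at this
  rw [inv_mul_eq_div, le_div_iff₀ hm]
  linarith

section Gradient

variable {E : Type*} [NormedAddCommGroup E] [InnerProductSpace ℝ E] [FiniteDimensional ℝ E]
  {J : E → ℝ}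

lemma ContDiff.gradient_one (hJ : ContDiff ℝ 2 J) : ContDiff ℝ 1 (gradient J) :=
  (InnerProductSpace.toDual ℝ E).symm.contDiff.comp
    (hJ.fderiv_right (m := 1) (by norm_num [one_add_one_eq_two]))

lemma ContDiff.hasStrictFDerivAt_gradient (hJ : ContDiff ℝ 2 J) (q : E) :
    HasStrictFDerivAt (gradient J) (fderiv ℝ (gradient J) q) q :=
  hJ.gradient_one.contDiffAt.hasStrictFDerivAt one_ne_zero

lemma inner_fderiv_gradient_comm (hJ : ContDiff ℝ 2 J) (q u v : E) :
    inner ℝ (fderiv ℝ (gradient J) q u) v = inner ℝ u (fderiv ℝ (gradient J) q v) := by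
  have key : ∀ a b : E, inner ℝ (fderiv ℝ (gradient J) q a) b =
      fderiv ℝ (fderiv ℝ J) q a b := by
    intro a b
    have h : fderiv ℝ J = fun y => InnerProductSpace.toDual ℝ E (gradient J y) :=
      toDual_comp_gradient.symm
    have h2 := ((InnerProductSpace.toDual ℝ E).toContinuousLinearEquiv.toContinuousLinearMap
      |>.hasFDerivAt).comp q (hJ.hasStrictFDerivAt_gradient q).hasFDerivAt
    have h3 := h2.fderiv
    change fderiv ℝ (fun y => InnerProductSpace.toDual ℝ E (gradient J y)) q = _ at h3
    rw [← h] at h3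
    rw [h3]
    rfl
  have hsymm : IsSymmSndFDerivAt ℝ J q := hJ.contDiffAt.isSymmSndFDerivAt (by simp)
  rw [key, hsymm u v, ← key, real_inner_comm]

/-- Second-order sufficient condition for a local minimum. -/
lemma isLocalMin_of_fderiv_gradient_nonneg (hJ : ContDiff ℝ 2 J) {q : E} (hq : gradient J q = 0)
    (hinj : Function.Injective (fderiv ℝ (gradient J) q))
    (hpos : ∀ u, 0 ≤ inner ℝ (fderiv ℝ (gradient J) q u) u) : IsLocalMin J q := by
  set H := fderiv ℝ (gradient J) q with hH
  have hsymm := inner_fderiv_gradient_comm hJ q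
  rw [← hH] at hsymm
  have hdef : ∀ u, inner ℝ (H u) u = 0 → u = 0 := by
    intro u hu
    have hquad : ∀ t : ℝ, 0 ≤ inner ℝ (H (H u)) (H u) * (t * t) + 2 * ‖H u‖ ^ 2 * t + 0 := by
      intro t
      have := hpos (u + t • H u)
      simp only [map_add, map_smul, inner_add_left, inner_add_right, inner_smul_left,
        inner_smul_right, hu, hsymm (H u) u, real_inner_self_eq_norm_sq, conj_trivial] at this
      linarith
    have := discrim_le_zero hquad
    simp only [discrim] at this
    have h0 : ‖H u‖ ^ 2 = 0 := by nlinarith [sq_nonneg (‖H u‖ ^ 2)]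
    have : H u = 0 := by simpa using h0
    exact hinj (by simpa using this)
  have hcont : Continuous fun u => inner ℝ (H u) u := by fun_prop
  obtain ⟨m, hm, hmS⟩ := (isCompact_sphere (0 : E) 1).exists_forall_le' (a := 0)
    hcont.continuousOn (fun u hu => (hpos u).lt_of_ne' fun h0 => by
      rw [hdef u h0] at hu; simp at hu)
  have hlow : ∀ u, m * ‖u‖ ^ 2 ≤ inner ℝ (H u) u := by
    intro u
    rcases eq_or_ne u 0 with rfl | hu
    · simp
    have hn : 0 < ‖u‖ := norm_pos_iff.2 hu
    have := hmS (‖u‖⁻¹ • u) (by simp [norm_smul, hn.ne'])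
    simp only [map_smul, inner_smul_left, inner_smul_right, conj_trivial] at this
    field_simp at this
    linarith
  have hev := (hJ.hasStrictFDerivAt_gradient q).hasFDerivAt.isLittleO.def hm
  obtain ⟨r, hr, hball⟩ := Metric.eventually_nhds_iff.1 hev
  refine Metric.eventually_nhds_iff.2 ⟨r, hr, fun y hy => ?_⟩
  have hgrad : ∀ t ∈ Set.Icc (0 : ℝ) 1, 0 ≤ t * inner ℝ (gradient J (q + t • (y - q))) (y - q) := by
    intro t ht
    have hb := @hball (q + t • (y - q)) (by
      rw [dist_self_add_left, norm_smul, Real.norm_eq_abs, abs_of_nonneg ht.1]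
      rw [dist_eq_norm] at hy
      nlinarith [ht.2, norm_nonneg (y - q)])
    rw [hq, sub_zero, add_sub_cancel_left] at hb
    have h1 := abs_le.1 (abs_real_inner_le_norm
      (gradient J (q + t • (y - q)) - H (t • (y - q))) (t • (y - q)))
    have h2 := hlow (t • (y - q))
    have h3 := mul_le_mul_of_nonneg_right hb (norm_nonneg (t • (y - q)))
    rw [inner_sub_left] at h1
    have h4 : 0 ≤ inner ℝ (gradient J (q + t • (y - q))) (t • (y - q)) := by
      nlinarith [h1.1]
    rwa [inner_smul_right] at h4
  have hder : ∀ t : ℝ, HasDerivAt (fun t : ℝ => J (q + t • (y - q)))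
      (inner ℝ (gradient J (q + t • (y - q))) (y - q)) t := by
    intro t
    have h1 := ((hJ.differentiable two_ne_zero) (q + t • (y - q))).hasFDerivAt
    have h2 : HasDerivAt (fun t : ℝ => q + t • (y - q)) (y - q) t := by
      simpa using ((hasDerivAt_id t).smul_const (y - q)).const_add q
    rw [inner_gradient_left]
    exact h1.comp_hasDerivAt t h2
  have hmono := monotoneOn_of_deriv_nonneg (convex_Icc (0 : ℝ) 1)
    (fun t _ => (hder t).continuousAt.continuousWithinAt)
    (fun t _ => (hder t).differentiableAt.differentiableWithinAt) (fun t ht => by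
      rw [interior_Icc] at ht
      rw [(hder t).deriv]
      exact nonneg_of_mul_nonneg_right (hgrad t ⟨ht.1.le, ht.2.le⟩) ht.1)
  simpa using hmono (Set.left_mem_Icc.2 zero_le_one) (Set.right_mem_Icc.2 zero_le_one) zero_le_one

lemma exists_inner_fderiv_gradient_neg (hJ : ContDiff ℝ 2 J) {q : E} (hq : gradient J q = 0)
    (hinj : Function.Injective (fderiv ℝ (gradient J) q)) (hmin : ¬ IsLocalMin J q) :
    ∃ u, inner ℝ (fderiv ℝ (gradient J) q u) u < 0 := by
  by_contra! h
  exact hmin (isLocalMin_of_fderiv_gradient_nonneg hJ hq hinj h)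

lemma exists_norm_le_fderiv_gradient {q : E}
    (hinj : Function.Injective (fderiv ℝ (gradient J) q)) :
    ∃ C : NNReal, 0 < C ∧ AntilipschitzWith C (fderiv ℝ (gradient J) q) :=
  LinearMap.exists_antilipschitzWith (fderiv ℝ (gradient J) q).toLinearMap
    (LinearMap.ker_eq_bot.2 hinj)

lemma eventually_gradient_ne_zero (hJ : ContDiff ℝ 2 J)
    (hinj : ∀ q, gradient J q = 0 → Function.Injective (fderiv ℝ (gradient J) q)) (q : E)
    (hq : gradient J q = 0) : ∀ᶠ y in 𝓝[≠] q, gradient J y ≠ 0 := by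
  obtain ⟨C, -, hC⟩ := exists_norm_le_fderiv_gradient (hinj q hq)
  exact (hJ.hasStrictFDerivAt_gradient q).hasFDerivAt.eventually_ne ⟨C, hC⟩

lemma countable_gradient_eq_zero (hJ : ContDiff ℝ 2 J)
    (hinj : ∀ q, gradient J q = 0 → Function.Injective (fderiv ℝ (gradient J) q)) :
    {q | gradient J q = 0}.Countable := by
  refine (HereditarilyLindelofSpace.isLindelof _).countable_of_isDiscrete ?_
  rw [isDiscrete_iff_nhdsNE]
  intro q hq
  rw [inf_principal_eq_bot]
  exact eventually_gradient_ne_zero hJ hinj q hq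

end Gradient

section DIN

variable {E : Type*} [NormedAddCommGroup E] [InnerProductSpace ℝ E]

/-- The linear change of variables `(θ, ψ) ↦ (α − 1/β)θ + (1/β)ψ`, that is `−ψ'` along DIN. -/
noncomputable def dinMomentum (α β : ℝ) : E × E →L[ℝ] E :=
  (α - 1 / β) • ContinuousLinearMap.fst ℝ E E + (1 / β) • ContinuousLinearMap.snd ℝ E E

lemma dinMomentum_apply (α β : ℝ) (z : E × E) :
    dinMomentum α β z = (α - 1 / β) • z.1 + (1 / β) • z.2 := rfl

/-- The vector field of the DIN system with the gradient replaced by a general map `g`. -/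
noncomputable def dinField (g : E → E) (α β : ℝ) (z : E × E) : E × E :=
  (-dinMomentum α β z - β • g z.1, -dinMomentum α β z)

/-- Trajectories of the DIN system on `[0, ∞)`. -/
def IsDINTrajectory (g : E → E) (α β : ℝ) (x : ℝ → E × E) : Prop :=
  ContinuousOn x (Set.Ici 0) ∧ ∀ t > 0, HasDerivAt x (dinField g α β (x t)) t

lemma dinMomentum_dinField {g : E → E} {α β : ℝ} (hβ : β ≠ 0) (z : E × E) :
    dinMomentum α β (dinField g α β z) = -α • dinMomentum α β z + (1 - α * β) • g z.1 := by
  simp only [dinField, dinMomentum_apply]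
  match_scalars <;> field_simp <;> ring

lemma snd_eq_dinMomentum {α β : ℝ} (hβ : β ≠ 0) (z : E × E) :
    z.2 = β • dinMomentum α β z + (1 - α * β) • z.1 := by
  rw [dinMomentum_apply]
  match_scalars <;> field_simp
  ring

lemma continuous_dinField {g : E → E} (hg : Continuous g) (α β : ℝ) :
    Continuous (dinField g α β) := by
  unfold dinField
  fun_prop

lemma contDiff_dinField {g : E → E} (hg : ContDiff ℝ 1 g) (α β : ℝ) :
    ContDiff ℝ 1 (dinField g α β) := by
  unfold dinField
  fun_prop

namespace IsDINTrajectory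

variable {g : E → E} {α β : ℝ} {x y : ℝ → E × E}

lemma hasDerivAt_fst (hx : IsDINTrajectory g α β x) {t : ℝ} (ht : 0 < t) :
    HasDerivAt (fun t => (x t).1) (-dinMomentum α β (x t) - β • g (x t).1) t :=
  (ContinuousLinearMap.fst ℝ E E).hasFDerivAt.comp_hasDerivAt t (hx.2 t ht)

lemma hasDerivAt_dinMomentum (hx : IsDINTrajectory g α β x) (hβ : β ≠ 0) {t : ℝ} (ht : 0 < t) :
    HasDerivAt (fun t => dinMomentum α β (x t))
      (-α • dinMomentum α β (x t) + (1 - α * β) • g (x t).1) t := by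
  exact ((dinMomentum α β).hasFDerivAt.comp_hasDerivAt t (hx.2 t ht)).congr_deriv
    (dinMomentum_dinField hβ _)

end IsDINTrajectory

section Convergence

variable {J : E → ℝ} {α β : ℝ} {x : ℝ → E × E}

lemma IsDINTrajectory.hasDerivAt_energy [CompleteSpace E] (hJ : Differentiable ℝ J) (hβ : β ≠ 0)
    (hx : IsDINTrajectory (gradient J) α β x) {t : ℝ} (ht : 0 < t) :
    HasDerivAt (fun t => (1 + α * β) * J (x t).1 + ‖dinMomentum α β (x t)‖ ^ 2 / 2)
      (-(β * ‖gradient J (x t).1‖ ^ 2 +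
        α * ‖dinMomentum α β (x t) + β • gradient J (x t).1‖ ^ 2)) t := by
  have h1 : HasDerivAt (fun t => J (x t).1) _ t :=
    (hJ (x t).1).hasFDerivAt.comp_hasDerivAt t (hx.hasDerivAt_fst ht)
  have h2 := (hx.hasDerivAt_dinMomentum hβ ht).norm_sq
  refine ((h1.const_mul (1 + α * β)).add (h2.div_const 2)).congr_deriv ?_
  rw [← inner_gradient_left, norm_add_sq_real]
  simp only [inner_sub_right, inner_neg_right, inner_smul_right, inner_add_right,
    real_inner_self_eq_norm_sq, norm_smul, Real.norm_eq_abs, mul_pow, sq_abs,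
    real_inner_comm (gradient J (x t).1)]
  ring

/-- Every trajectory converges to an equilibrium when `J` is coercive with isolated critical
points. -/
lemma IsDINTrajectory.exists_tendsto [FiniteDimensional ℝ E] (hJ : ContDiff ℝ 1 J)
    (hJc : Tendsto J (cocompact E) atTop)
    (hiso : ∀ q, gradient J q = 0 → ∀ᶠ y in 𝓝[≠] q, gradient J y ≠ 0)
    (hg : Continuous (gradient J)) (hα : 0 ≤ α) (hβ : 0 < β)
    (hx : IsDINTrajectory (gradient J) α β x) :
    ∃ q, gradient J q = 0 ∧ Tendsto x atTop (𝓝 (q, (1 - α * β) • q)) := by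
  have hd : Differentiable ℝ J := hJ.differentiable one_ne_zero
  set S : ℝ → ℝ := fun t => (1 + α * β) * J (x t).1 + ‖dinMomentum α β (x t)‖ ^ 2 / 2 with hS
  have hA : 0 < 1 + α * β := by positivity
  have hanti : AntitoneOn S (Set.Ici 0) := by
    refine antitoneOn_of_deriv_nonpos (convex_Ici 0) ?_ ?_ ?_
    · have h1 : Continuous fun z : E × E =>
          (1 + α * β) * J z.1 + ‖dinMomentum α β z‖ ^ 2 / 2 := by
        have := hJ.continuous
        fun_prop
      exact h1.comp_continuousOn hx.1
    · intro t ht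
      rw [interior_Ici] at ht
      exact (hx.hasDerivAt_energy hd hβ.ne' ht).differentiableAt.differentiableWithinAt
    · intro t ht
      rw [interior_Ici] at ht
      rw [(hx.hasDerivAt_energy hd hβ.ne' ht).deriv, neg_nonpos]
      positivity
  obtain ⟨p, hp⟩ := hJ.continuous.exists_forall_le hJc
  have hSle : ∀ t ≥ 0, S t ≤ S 0 := fun t ht => hanti (Set.self_mem_Ici) ht ht
  have hSge : ∀ t, (1 + α * β) * J p ≤ S t := fun t => by
    have := mul_le_mul_of_nonneg_left (hp (x t).1) hA.le
    simp only [hS]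
    nlinarith [sq_nonneg ‖dinMomentum α β (x t)‖]
  obtain ⟨K, hK, hKJ⟩ := mem_cocompact.1
    (hJc.eventually_gt_atTop (S 0 / (1 + α * β)))
  obtain ⟨R₁, hR₁⟩ := hK.isBounded.exists_norm_le
  have hθ : ∀ t ≥ 0, ‖(x t).1‖ ≤ R₁ := by
    intro t ht
    refine hR₁ _ (by_contra fun hcon => ?_)
    have h1 : S 0 / (1 + α * β) < J (x t).1 := hKJ hcon
    rw [div_lt_iff₀ hA] at h1
    have h2 := hSle t ht
    simp only [hS] at h1 h2
    nlinarith [sq_nonneg ‖dinMomentum α β (x t)‖]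
  have hv : ∀ t ≥ 0, ‖dinMomentum α β (x t)‖ ≤ √(2 * (S 0 - (1 + α * β) * J p)) := by
    intro t ht
    refine Real.le_sqrt_of_sq_le ?_
    have h1 := hSle t ht
    have h2 := mul_le_mul_of_nonneg_left (hp (x t).1) hA.le
    simp only [hS] at h1 ⊢
    linarith
  obtain ⟨R, hR⟩ : ∃ R, ∀ t ≥ 0, ‖x t‖ ≤ R := by
    refine ⟨max R₁ (β * √(2 * (S 0 - (1 + α * β) * J p)) + |1 - α * β| * R₁), fun t ht => ?_⟩
    refine max_le_max (hθ t ht) ?_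
    rw [snd_eq_dinMomentum (α := α) hβ.ne' (x t)]
    refine (norm_add_le _ _).trans ?_
    rw [norm_smul, norm_smul, Real.norm_eq_abs, Real.norm_eq_abs, abs_of_pos hβ]
    gcongr
    exacts [hv t ht, hθ t ht]
  obtain ⟨l, hl⟩ : ∃ l, Tendsto S atTop (𝓝 l) := by
    have hmono : Antitone fun t => S (max t 0) := fun s t hst =>
      hanti (Set.mem_Ici.2 (le_max_right _ _)) (Set.mem_Ici.2 (le_max_right _ _))
        (max_le_max_right 0 hst)
    refine ⟨_, (tendsto_atTop_ciInf hmono ⟨(1 + α * β) * J p, ?_⟩).congr' ?_⟩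
    · rintro _ ⟨t, rfl⟩
      exact hSge _
    · filter_upwards [eventually_ge_atTop 0] with t ht
      rw [max_eq_left ht]
  have hF := continuous_dinField hg α β
  have hR' : ∀ t > 0, ‖x t‖ ≤ R := fun t ht => hR t (le_of_lt ht)
  have hdiss := tendsto_zero_of_hasDerivAt_comp hF hx.2 hR'
    (G := fun z => -(β * ‖gradient J z.1‖ ^ 2 + α * ‖dinMomentum α β z + β • gradient J z.1‖ ^ 2))
    (by fun_prop) (fun t ht => hx.hasDerivAt_energy hd hβ.ne' ht) hl
  have hgrad : Tendsto (fun t => gradient J (x t).1) atTop (𝓝 0) := by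
    have h1 : Tendsto (fun t => ‖gradient J (x t).1‖ ^ 2) atTop (𝓝 0) := by
      refine squeeze_zero (fun t => sq_nonneg _) (fun t => ?_)
        (by simpa using hdiss.neg.const_mul β⁻¹)
      rw [le_inv_mul_iff₀ hβ]
      have : 0 ≤ α * ‖dinMomentum α β (x t) + β • gradient J (x t).1‖ ^ 2 := by positivity
      linarith
    have h2 := h1.sqrt
    simp only [Real.sqrt_sq (norm_nonneg _), Real.sqrt_zero] at h2
    exact tendsto_zero_iff_norm_tendsto_zero.2 h2
  obtain ⟨q, hq, hlim⟩ := exists_tendsto_of_isolated_zeros (x := fun t => (x t).1)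
    (continuous_fst.comp_continuousOn hx.1) hθ hg hiso hgrad
  have hder := tendsto_zero_of_hasDerivAt_comp hF hx.2 hR'
    (G := fun z => -dinMomentum α β z - β • gradient J z.1)
    (by fun_prop) (fun t ht => hx.hasDerivAt_fst ht) hlim
  have hmom : Tendsto (fun t => dinMomentum α β (x t)) atTop (𝓝 0) := by
    simpa using (hder.add (hgrad.const_smul β)).neg
  refine ⟨q, hq, hlim.prodMk_nhds ?_⟩
  simpa [← snd_eq_dinMomentum hβ.ne'] using
    (hmom.const_smul β).add (hlim.const_smul (1 - α * β))

end Convergence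

section Saddle

variable {α β : ℝ} {g : E → E} {H : E →L[ℝ] E}

/-- The quadratic function `−(1 + αβ)/2 ⟪Hu, u⟫ − ‖w‖²/2 − ε⟪u, w⟫` with `w` the momentum. -/
noncomputable def saddleForm (H : E →L[ℝ] E) (α β ε : ℝ) (z : E × E) : ℝ :=
  -((1 + α * β) / 2 * inner ℝ (H z.1) z.1) - ‖dinMomentum α β z‖ ^ 2 / 2 -
    ε * inner ℝ z.1 (dinMomentum α β z)

lemma continuous_saddleForm (H : E →L[ℝ] E) (α β ε : ℝ) : Continuous (saddleForm H α β ε) := by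
  unfold saddleForm
  fun_prop

lemma saddleForm_smul (H : E →L[ℝ] E) (α β ε c : ℝ) (z : E × E) :
    saddleForm H α β ε (c • z) = c ^ 2 * saddleForm H α β ε z := by
  simp only [saddleForm, map_smul, Prod.smul_fst, inner_smul_left, inner_smul_right, norm_smul,
    mul_pow, Real.norm_eq_abs, sq_abs, conj_trivial]
  ring

lemma saddleForm_pos (hβ : β ≠ 0) (hA : 0 < 1 + α * β) (ε : ℝ) {u : E}
    (hu : inner ℝ (H u) u < 0) : 0 < saddleForm H α β ε (u, (1 - α * β) • u) := by
  have : dinMomentum α β (u, (1 - α * β) • u) = 0 := by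
    rw [dinMomentum_apply]
    match_scalars
    field_simp
    ring
  simp only [saddleForm, this, norm_zero, inner_zero_right]
  nlinarith

lemma hasDerivAt_saddleForm (hH : ∀ u v, inner ℝ (H u) v = inner ℝ u (H v)) (hβ : β ≠ 0) (ε : ℝ)
    {x y : ℝ → E × E} (hx : IsDINTrajectory g α β x) (hy : IsDINTrajectory g α β y) {t : ℝ}
    (ht : 0 < t) {u w k : E} (hu : u = (x t).1 - (y t).1) (hw : w = dinMomentum α β (x t - y t))
    (hk : k = g (x t).1 - g (y t).1) :
    HasDerivAt (fun t => saddleForm H α β ε (x t - y t))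
      (-((1 + α * β) * inner ℝ (H u) (-w - β • k)) - inner ℝ w (-α • w + (1 - α * β) • k) -
        ε * (inner ℝ u (-α • w + (1 - α * β) • k) + inner ℝ (-w - β • k) w)) t := by
  have h1 : HasDerivAt (fun t => (x t - y t).1) (-w - β • k) t := by
    refine ((hx.hasDerivAt_fst ht).sub (hy.hasDerivAt_fst ht)).congr_deriv ?_
    rw [hw, hk, map_sub]
    module
  have h2 : HasDerivAt (fun t => dinMomentum α β (x t - y t)) (-α • w + (1 - α * β) • k) t := by
    refine ((dinMomentum α β).hasFDerivAt.comp_hasDerivAt t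
      ((hx.2 t ht).sub (hy.2 t ht))).congr_deriv ?_
    rw [map_sub, dinMomentum_dinField hβ, dinMomentum_dinField hβ, hw, hk, map_sub]
    module
  have h3 : HasDerivAt (fun t => H (x t - y t).1) (H (-w - β • k)) t :=
    H.hasFDerivAt.comp_hasDerivAt t h1
  refine (((((h3.inner ℝ h1).const_mul ((1 + α * β) / 2)).neg).sub
    (h2.norm_sq.div_const 2)).sub ((h1.inner ℝ h2).const_mul ε)).congr_deriv ?_
  rw [hH (-w - β • k), real_inner_comm (H _) (-w - β • k), Prod.fst_sub, ← hu, ← hw]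
  ring

lemma saddleForm_deriv_eq (hβ : 0 < β) {ε : ℝ} {h w k r : E} (u : E) (hr : k = h + r) :
    -((1 + α * β) * inner ℝ h (-w - β • k)) - inner ℝ w (-α • w + (1 - α * β) • k) -
        ε * (inner ℝ u (-α • w + (1 - α * β) • k) + inner ℝ (-w - β • k) w) =
      β * ‖k‖ ^ 2 + α * ‖w + β • k‖ ^ 2 - (1 + α * β) * inner ℝ r w -
        (1 + α * β) * β * inner ℝ r k + ε * ‖w‖ ^ 2 + ε * β * inner ℝ k w + ε * α * inner ℝ u w -
        ε * ((1 - α * β) * inner ℝ u k) := by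
  have hsq := norm_add_sq_real w (β • k)
  rw [inner_smul_right, norm_smul, Real.norm_eq_abs, abs_of_pos hβ] at hsq
  rw [eq_sub_of_add_eq hr.symm, hsq]
  simp only [inner_sub_left, inner_sub_right, inner_add_right, inner_smul_left,
    inner_smul_right, inner_neg_left, inner_neg_right, real_inner_self_eq_norm_sq,
    conj_trivial, real_inner_comm k w]
  ring

/-- For a suitable cross term, the saddle form increases along linearised differences, with room
for a small perturbation `r` of the linear part. -/
lemma exists_saddle_parameters (hα : 0 ≤ α) (hβ : 0 < β) {C : ℝ} (hC : 0 < C)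
    (hHC : ∀ u, ‖u‖ ≤ C * ‖H u‖) :
    ∃ ε η : ℝ, 0 < η ∧ ∀ u w k : E, ‖k - H u‖ ≤ η * ‖u‖ →
      0 ≤ -((1 + α * β) * inner ℝ (H u) (-w - β • k)) - inner ℝ w (-α • w + (1 - α * β) • k) -
        ε * (inner ℝ u (-α • w + (1 - α * β) • k) + inner ℝ (-w - β • k) w) := by
  set A := 1 + α * β with hA
  have hA0 : 0 < A := by positivity
  set D := β + α * (2 * C) with hD
  set D' := |1 - α * β| * (2 * C) with hD'
  set ε := β / (D ^ 2 + D' + 1 + β) with hε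
  have hε0 : 0 < ε := by positivity
  have hεeq : ε * (D ^ 2 + D' + 1 + β) = β := by
    rw [hε, div_mul_cancel₀]; positivity
  refine ⟨ε, min (1 / (2 * C)) (ε / (A * (2 * C))), by positivity, fun u w k hk => ?_⟩
  generalize hr : k - H u = r at hk
  have hHu : H u = k - r := by rw [← hr]; abel
  have hun := norm_nonneg u
  have hr1 : ‖r‖ ≤ 1 / (2 * C) * ‖u‖ := hk.trans (by gcongr; exact min_le_left _ _)
  have hr2 : ‖r‖ ≤ ε / (A * (2 * C)) * ‖u‖ := hk.trans (by gcongr; exact min_le_right _ _)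
  have huk : ‖u‖ ≤ 2 * C * ‖k‖ := by
    have h1 := hHC u
    have h2 : ‖H u‖ ≤ ‖k‖ + ‖r‖ := by rw [hHu]; exact norm_sub_le _ _
    have h3 : C * ‖r‖ ≤ ‖u‖ / 2 := by
      calc C * ‖r‖ ≤ C * (1 / (2 * C) * ‖u‖) := by gcongr
        _ = ‖u‖ / 2 := by field_simp
    nlinarith
  have hrk : A * ‖r‖ ≤ ε * ‖k‖ := by
    calc A * ‖r‖ ≤ A * (ε / (A * (2 * C)) * (2 * C * ‖k‖)) := by
          gcongr; exact hr2.trans (by gcongr)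
      _ = ε * ‖k‖ := by field_simp
  have i1 := (abs_le.1 (abs_real_inner_le_norm r w)).1
  have i2 := (abs_le.1 (abs_real_inner_le_norm r k)).1
  have i2' := (abs_le.1 (abs_real_inner_le_norm r k)).2
  have i1' := (abs_le.1 (abs_real_inner_le_norm r w)).2
  have i3 := (abs_le.1 (abs_real_inner_le_norm k w)).1
  have i4 := (abs_le.1 (abs_real_inner_le_norm u w)).1
  have i5 : (1 - α * β) * inner ℝ u k ≤ D' * ‖k‖ ^ 2 := by
    calc (1 - α * β) * inner ℝ u k ≤ |1 - α * β| * (‖u‖ * ‖k‖) := by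
          refine (le_abs_self _).trans ?_
          rw [abs_mul]
          gcongr
          exact abs_real_inner_le_norm u k
      _ ≤ |1 - α * β| * (2 * C * ‖k‖ * ‖k‖) := by gcongr
      _ = D' * ‖k‖ ^ 2 := by ring
  have hpos : 0 ≤ α * ‖w + β • k‖ ^ 2 := by positivity
  rw [saddleForm_deriv_eq hβ u (r := r) (by rw [hHu]; abel), ← hA]
  have b1 : A * inner ℝ r w ≤ ε * ‖k‖ * ‖w‖ := by
    calc A * inner ℝ r w ≤ A * (‖r‖ * ‖w‖) := by gcongr
      _ = A * ‖r‖ * ‖w‖ := by ring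
      _ ≤ _ := by gcongr
  have b2 : A * β * inner ℝ r k ≤ ε * β * ‖k‖ ^ 2 := by
    calc A * β * inner ℝ r k ≤ A * β * (‖r‖ * ‖k‖) := by gcongr
      _ = A * ‖r‖ * (β * ‖k‖) := by ring
      _ ≤ ε * ‖k‖ * (β * ‖k‖) := by gcongr
      _ = _ := by ring
  have b3 : -(ε * β * (‖k‖ * ‖w‖)) ≤ ε * β * inner ℝ k w := by
    rw [← mul_neg]; gcongr
  have b4 : -(ε * (α * (2 * C)) * (‖k‖ * ‖w‖)) ≤ ε * α * inner ℝ u w := by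
    calc -(ε * (α * (2 * C)) * (‖k‖ * ‖w‖)) = -(ε * α * (2 * C * ‖k‖ * ‖w‖)) := by ring
      _ ≤ -(ε * α * (‖u‖ * ‖w‖)) := by gcongr
      _ = ε * α * -(‖u‖ * ‖w‖) := by ring
      _ ≤ _ := by gcongr
  have b5 := mul_le_mul_of_nonneg_left i5 hε0.le
  have c1 : ε * D * (‖k‖ * ‖w‖) ≤ ε * (‖w‖ ^ 2 / 4 + D ^ 2 * ‖k‖ ^ 2) := by
    nlinarith [mul_nonneg hε0.le (sq_nonneg (‖w‖ / 2 - D * ‖k‖))]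
  have c2 : ε * (‖k‖ * ‖w‖) ≤ ε * (‖w‖ ^ 2 / 4 + ‖k‖ ^ 2) := by
    nlinarith [mul_nonneg hε0.le (sq_nonneg (‖w‖ / 2 - ‖k‖))]
  have c3 : ε * D * (‖k‖ * ‖w‖) =
      ε * β * (‖k‖ * ‖w‖) + ε * (α * (2 * C)) * (‖k‖ * ‖w‖) := by rw [hD]; ring
  have c4 : β * ‖k‖ ^ 2 = ε * (D ^ 2 + D' + 1 + β) * ‖k‖ ^ 2 := by rw [hεeq]
  have c5 : 0 ≤ ε * ‖w‖ ^ 2 := by positivity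
  linarith

/-- Differences of trajectories which stay near a nondegenerate critical point and have the same
limit lie in the nonpositive cone of the saddle form. -/
lemma saddleForm_sub_nonpos (hH : ∀ u v, inner ℝ (H u) v = inner ℝ u (H v)) (hβ : β ≠ 0) {ε η : ℝ}
    (hε : ∀ u w k : E, ‖k - H u‖ ≤ η * ‖u‖ →
      0 ≤ -((1 + α * β) * inner ℝ (H u) (-w - β • k)) - inner ℝ w (-α • w + (1 - α * β) • k) -
        ε * (inner ℝ u (-α • w + (1 - α * β) • k) + inner ℝ (-w - β • k) w))
    {U : Set E} (hU : ∀ a ∈ U, ∀ b ∈ U, ‖g a - g b - H (a - b)‖ ≤ η * ‖a - b‖)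
    {x y : ℝ → E × E} (hx : IsDINTrajectory g α β x) (hy : IsDINTrajectory g α β y)
    {N : ℝ} (hN : 0 ≤ N) (hxU : ∀ t ≥ N, (x t).1 ∈ U) (hyU : ∀ t ≥ N, (y t).1 ∈ U) {q : E × E}
    (hxq : Tendsto x atTop (𝓝 q)) (hyq : Tendsto y atTop (𝓝 q)) :
    saddleForm H α β ε (x N - y N) ≤ 0 := by
  have hcont := continuous_saddleForm H α β ε
  have hder := fun (t : ℝ) (ht : 0 < t) =>
    hasDerivAt_saddleForm (H := H) hH hβ ε hx hy (t := t) ht rfl rfl rfl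
  have hmono : MonotoneOn (fun t => saddleForm H α β ε (x t - y t)) (Set.Ici N) := by
    refine monotoneOn_of_deriv_nonneg (convex_Ici N) ?_ ?_ ?_
    · exact hcont.comp_continuousOn
        ((hx.1.sub hy.1).mono fun t ht => hN.trans ht)
    · intro t ht
      rw [interior_Ici] at ht
      exact (hder t (hN.trans_lt ht)).differentiableAt.differentiableWithinAt
    · intro t ht
      rw [interior_Ici] at ht
      rw [(hder t (hN.trans_lt ht)).deriv]
      exact hε _ _ _ (hU _ (hxU t (le_of_lt ht)) _ (hyU t (le_of_lt ht)))
  have hlim : Tendsto (fun t => saddleForm H α β ε (x t - y t)) atTop (𝓝 0) := by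
    have := (hcont.tendsto _).comp (hxq.sub hyq)
    have h0 : saddleForm H α β ε 0 = 0 := by simp [saddleForm]
    rwa [sub_self, h0] at this
  refine ge_of_tendsto hlim ?_
  filter_upwards [eventually_ge_atTop N] with t ht
  exact hmono Set.self_mem_Ici ht ht

/-- The initial conditions of trajectories bounded by `R` up to time `N`, staying in `U` after time
`N`, and converging to `q`. -/
def trappedSet (g : E → E) (α β : ℝ) (q : E × E) (U : Set E) (N R : ℝ) : Set (E × E) :=
  {p | ∃ x, x 0 = p ∧ IsDINTrajectory g α β x ∧ (∀ t ∈ Set.Icc 0 N, x t ∈ Metric.closedBall 0 R) ∧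
    (∀ t ≥ N, (x t).1 ∈ U) ∧ Tendsto x atTop (𝓝 q)}

lemma exists_volume_trappedSet_eq_zero [FiniteDimensional ℝ E] [MeasurableSpace (E × E)]
    [BorelSpace (E × E)] (μ : Measure (E × E)) [μ.IsAddHaarMeasure]
    (hg : ContDiff ℝ 1 g) {a : E} (hga : HasStrictFDerivAt g H a)
    (hH : ∀ u v, inner ℝ (H u) v = inner ℝ u (H v)) {C : NNReal} (hC : 0 < C)
    (hHC : AntilipschitzWith C H) {u : E} (hu : inner ℝ (H u) u < 0) (hα : 0 ≤ α) (hβ : 0 < β)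
    (q : E × E) :
    ∃ U ∈ 𝓝 a, ∀ N ≥ 0, ∀ R, μ (trappedSet g α β q U N R) = 0 := by
  obtain ⟨ε, η, hη, hε⟩ := exists_saddle_parameters (H := H) hα hβ (NNReal.coe_pos.2 hC)
    (fun u => by simpa using hHC.le_mul_dist u 0)
  obtain ⟨U, hUa, hU⟩ : ∃ U ∈ 𝓝 a, ∀ b ∈ U, ∀ c ∈ U, ‖g b - g c - H (b - c)‖ ≤ η * ‖b - c‖ := by
    have h := hga.isLittleO.def hη
    rw [nhds_prod_eq] at h
    exact (eventually_prod_self_iff (r := fun b c => ‖g b - g c - H (b - c)‖ ≤ η * ‖b - c‖)).1 h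
  have hA : 0 < 1 + α * β := by positivity
  have hpos := saddleForm_pos hβ.ne' hA ε hu
  obtain ⟨π, C', hC', hπ⟩ := exists_norm_le_of_quadratic (continuous_saddleForm H α β ε)
    (saddleForm_smul H α β ε) hpos
  refine ⟨U, hUa, fun N hN R => ?_⟩
  obtain ⟨K, hK⟩ := (contDiff_dinField hg α β).contDiffOn.exists_lipschitzOnWith one_ne_zero
    (convex_closedBall (0 : E × E) R) (isCompact_closedBall 0 R)
  choose! X hX0 hX hXR hXU hXq using fun p (hp : p ∈ trappedSet g α β q U N R) => hp
  have hne : (u, (1 - α * β) • u) ≠ (0 : E × E) := by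
    intro h0
    rw [h0] at hpos
    simp [saddleForm] at hpos
  have : Nontrivial (E × E) := nontrivial_of_ne _ _ hne
  have hfin := Module.finrank_pos (R := ℝ) (M := E × E)
  refine volume_eq_zero_of_dist_le (W := Fin (Module.finrank ℝ (E × E) - 1) → ℝ)
    (by rw [Module.finrank_fin_fun]; omega) μ _ (fun p => π (X p N)) (Real.exp (K * N) * C')
    (by positivity) fun p hp p' hp' => ?_
  have h1 := dist_zero_le_of_trajectories hK hN (hX p hp).1 (hX p hp).2 (hXR p hp)
    (hX p' hp').1 (hX p' hp').2 (hXR p' hp')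
  rw [hX0 p hp, hX0 p' hp'] at h1
  have h2 := hπ _ (saddleForm_sub_nonpos hH hβ.ne' hε hU (hX p hp) (hX p' hp') hN (hXU p hp)
    (hXU p' hp') (hXq p hp) (hXq p' hp'))
  rw [map_sub, ← dist_eq_norm, ← dist_eq_norm] at h2
  rw [mul_assoc]
  exact h1.trans (by gcongr)

end Saddle

end DIN

lemma IsDINSolution.isDINTrajectory {P : ℕ} {J : EuclideanSpace ℝ (Fin P) → ℝ} {α β : ℝ}
    {θ ψ : ℝ → EuclideanSpace ℝ (Fin P)} (h : IsDINSolution J α β θ ψ) :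
    IsDINTrajectory (gradient J) α β fun t => (θ t, ψ t) := by
  obtain ⟨hθ, hψ, hθ', hψ'⟩ := h
  refine ⟨hθ.prodMk hψ, fun t ht => ((hθ' t ht).prodMk (hψ' t ht)).congr_deriv ?_⟩
  simp only [dinField, dinMomentum_apply]
  congr 1 <;> module

lemma mem_iUnion_trappedSet {E : Type*} [NormedAddCommGroup E] [InnerProductSpace ℝ E]
    {g : E → E} {α β : ℝ} {x : ℝ → E × E} (hx : IsDINTrajectory g α β x) {q : E × E}
    (hq : Tendsto x atTop (𝓝 q)) {U : Set E} (hU : U ∈ 𝓝 q.1) :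
    x 0 ∈ ⋃ (N : ℕ) (R : ℕ), trappedSet g α β q U N R := by
  have hev : ∀ᶠ t in atTop, (x t).1 ∈ U := (continuous_fst.tendsto q).comp hq hU
  obtain ⟨T, hT⟩ := eventually_atTop.1 hev
  obtain ⟨N, hN⟩ := exists_nat_ge T
  obtain ⟨r, hr⟩ := (isCompact_Icc.image_of_continuousOn
    (hx.1.mono (Set.Icc_subset_Ici_self : Set.Icc 0 (N : ℝ) ⊆ _))).isBounded.exists_norm_le
  obtain ⟨R, hR⟩ := exists_nat_ge r
  refine Set.mem_iUnion₂.2 ⟨N, R, x, rfl, hx, fun t ht => ?_, fun t ht => hT t (hN.trans ht), hq⟩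
  exact mem_closedBall_zero_iff.2 ((hr _ ⟨t, ht, rfl⟩).trans hR)

/-- Corollary 1 of the paper.
Let `J : ℝ^P → ℝ` be a twice continuously differentiable, coercive Morse function,
`α ≥ 0`, `β > 0`.  Then:
(i) every solution of the DIN system converges as `t → ∞`;
(ii) for every probability law `μ` on `ℝ^P × ℝ^P` absolutely continuous with respect
to the Lebesgue measure, the set of initial conditions whose DIN solution converges
to a limit whose `θ`-component is *not* a local minimizer of `J` has `μ`-measure zero. -/
theorem din_converges_to_local_minima (P : ℕ) (J : EuclideanSpace ℝ (Fin P) → ℝ)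
    (hJ : ContDiff ℝ 2 J)
    (hMorse : ∀ θs : EuclideanSpace ℝ (Fin P), gradient J θs = 0 →
      Function.Injective (fderiv ℝ (gradient J) θs))
    (hcoercive : Tendsto J (cocompact (EuclideanSpace ℝ (Fin P))) atTop)
    (α β : ℝ) (hα : 0 ≤ α) (hβ : 0 < β) :
    (∀ θ ψ : ℝ → EuclideanSpace ℝ (Fin P), IsDINSolution J α β θ ψ →
      ∃ q : EuclideanSpace ℝ (Fin P) × EuclideanSpace ℝ (Fin P),
        Tendsto (fun t => (θ t, ψ t)) atTop (𝓝 q)) ∧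
    ∀ μ : Measure (EuclideanSpace ℝ (Fin P) × EuclideanSpace ℝ (Fin P)),
      IsProbabilityMeasure μ → μ ≪ volume →
      μ {p : EuclideanSpace ℝ (Fin P) × EuclideanSpace ℝ (Fin P) |
        ∃ θ ψ : ℝ → EuclideanSpace ℝ (Fin P),
          θ 0 = p.1 ∧ ψ 0 = p.2 ∧ IsDINSolution J α β θ ψ ∧
          ∃ q : EuclideanSpace ℝ (Fin P) × EuclideanSpace ℝ (Fin P),
            Tendsto (fun t => (θ t, ψ t)) atTop (𝓝 q) ∧ ¬ IsLocalMin J q.1} = 0 := by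
  have : (volume :
      Measure (EuclideanSpace ℝ (Fin P) × EuclideanSpace ℝ (Fin P))).IsAddHaarMeasure :=
    Measure.prod.instIsAddHaarMeasure volume volume
  have hiso := eventually_gradient_ne_zero hJ hMorse
  have hconv : ∀ x, IsDINTrajectory (gradient J) α β x →
      ∃ q, gradient J q = 0 ∧ Tendsto x atTop (𝓝 (q, (1 - α * β) • q)) := fun x hx =>
    hx.exists_tendsto (hJ.of_le one_le_two) hcoercive hiso hJ.gradient_one.continuous hα hβ
  refine ⟨fun θ ψ h => ?_, fun μ _ hμ => hμ ?_⟩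
  · obtain ⟨q, -, hq⟩ := hconv _ h.isDINTrajectory
    exact ⟨_, hq⟩
  set B := {q | gradient J q = 0 ∧ ¬ IsLocalMin J q} with hB
  have hnull : ∀ q ∈ B, ∃ U ∈ 𝓝 q, ∀ N ≥ 0, ∀ R,
      volume (trappedSet (gradient J) α β (q, (1 - α * β) • q) U N R) = 0 := by
    intro q hq
    obtain ⟨u, hu⟩ := exists_inner_fderiv_gradient_neg hJ hq.1 (hMorse q hq.1) hq.2
    obtain ⟨C, hC, hHC⟩ := exists_norm_le_fderiv_gradient (hMorse q hq.1)
    exact exists_volume_trappedSet_eq_zero volume hJ.gradient_one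
      (hJ.hasStrictFDerivAt_gradient q) (inner_fderiv_gradient_comm hJ q) hC hHC hu hα hβ _
  choose! U hUq hU using hnull
  have hBc : B.Countable := (countable_gradient_eq_zero hJ hMorse).mono fun q hq => hq.1
  refine measure_mono_null (t := ⋃ q ∈ B, ⋃ (N : ℕ) (R : ℕ),
    trappedSet (gradient J) α β (q, (1 - α * β) • q) (U q) N R) ?_ ?_
  · rintro ⟨p₁, p₂⟩ ⟨θ, ψ, rfl, rfl, hsol, q', hq', hmin⟩
    have hx := hsol.isDINTrajectory
    obtain ⟨q, hq0, hq⟩ := hconv _ hx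
    obtain rfl := tendsto_nhds_unique hq' hq
    have hqB : q ∈ B := ⟨hq0, hmin⟩
    exact Set.mem_biUnion hqB (mem_iUnion_trappedSet hx hq (hUq q hqB))
  · refine (measure_biUnion_null_iff hBc).2 fun q hq => ?_
    exact measure_iUnion_null fun N => measure_iUnion_null fun R =>
      hU q hq N (Nat.cast_nonneg N) R
end

section
/- Let J : ℝ^P → ℝ be a twice continuously differentiable, coercive Morse function with L-Lipschitz continuous gradient, let α > 0, β > 0, and let the step-size γ > 0 satisfy both 0 < γ < min(β/2 + α/(2L) − √((α + βL)² − 4L)/(2L), β) and 0 < γ < min(2α/((1 + αβ)L + α²), 1/α + β, 2β). Let (θ₀, ψ₀) be a random variable on ℝ^P × ℝ^P whose law is absolutely continuous with respect to Lebesgue measure, and let (θ_k, ψ_k)_{k∈ℕ} be the INNA iterates initialized at (θ₀, ψ₀). Then (θ_k)_{k∈ℕ} converges, and with probability one its limit θ* ∈ ℝ^P is a local minimizer of J. -/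
open Filter MeasureTheory Topology

/-- One step of the INNA algorithm with parameters `α`, `β` and step-size `γ`:
`θ⁺ = θ + γ[−(α − 1/β)θ − (1/β)ψ − β∇J(θ)]`, `ψ⁺ = ψ + γ[−(α − 1/β)θ − (1/β)ψ]`. -/
noncomputable def innaStep {P : ℕ} (J : EuclideanSpace ℝ (Fin P) → ℝ) (α β γ : ℝ)
    (p : EuclideanSpace ℝ (Fin P) × EuclideanSpace ℝ (Fin P)) :
    EuclideanSpace ℝ (Fin P) × EuclideanSpace ℝ (Fin P) :=
  (p.1 + γ • (-(α - 1 / β) • p.1 - (1 / β) • p.2 - β • gradient J p.1),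
   p.2 + γ • (-(α - 1 / β) • p.1 - (1 / β) • p.2))

open Set Metric
open scoped NNReal RealInnerProductSpace

section Energy

variable {E : Type*} [NormedAddCommGroup E] [InnerProductSpace ℝ E]

/-- The descent lemma for functions with a Lipschitz gradient. -/
theorem HasGradientAt.le_add_inner_add_sq [CompleteSpace E] {J : E → ℝ} {g : E → E} {L : ℝ}
    (hg : ∀ x, HasGradientAt J (g x) x) (hL : ∀ x y, ‖g x - g y‖ ≤ L * ‖x - y‖) (x d : E) :
    J (x + d) ≤ J x + ⟪g x, d⟫ + L / 2 * ‖d‖ ^ 2 := by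
  have hd : ∀ t : ℝ, HasDerivAt
      (fun t : ℝ => J (x + t • d) - t * ⟪g x, d⟫ - L / 2 * t ^ 2 * ‖d‖ ^ 2)
      (⟪g (x + t • d), d⟫ - ⟪g x, d⟫ - L * t * ‖d‖ ^ 2) t := by
    intro t
    have h1 : HasDerivAt (fun t : ℝ => x + t • d) d t := by
      simpa using ((hasDerivAt_id t).smul_const d).const_add x
    have h2 : HasDerivAt (fun t : ℝ => J (x + t • d)) ⟪g (x + t • d), d⟫ t := by
      exact (hg (x + t • d)).hasFDerivAt.comp_hasDerivAt t h1
    have h3 : HasDerivAt (fun t : ℝ => t * ⟪g x, d⟫) ⟪g x, d⟫ t := by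
      simpa using (hasDerivAt_id t).mul_const ⟪g x, d⟫
    have h4 : HasDerivAt (fun t : ℝ => L / 2 * t ^ 2 * ‖d‖ ^ 2) (L * t * ‖d‖ ^ 2) t :=
      (((hasDerivAt_pow 2 t).const_mul (L / 2)).mul_const (‖d‖ ^ 2)).congr_deriv (by
        push_cast
        ring)
    exact (h2.sub h3).sub h4
  have hanti : AntitoneOn
      (fun t : ℝ => J (x + t • d) - t * ⟪g x, d⟫ - L / 2 * t ^ 2 * ‖d‖ ^ 2) (Icc 0 1) := by
    refine antitoneOn_of_deriv_nonpos (convex_Icc 0 1)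
      (fun t _ => (hd t).continuousAt.continuousWithinAt)
      (fun t _ => (hd t).differentiableAt.differentiableWithinAt) fun t ht => ?_
    rw [interior_Icc] at ht
    rw [(hd t).deriv, ← inner_sub_left]
    have h1 := real_inner_le_norm (g (x + t • d) - g x) d
    have h2 := hL (x + t • d) x
    rw [add_sub_cancel_left, norm_smul, Real.norm_of_nonneg ht.1.le] at h2
    nlinarith [norm_nonneg d, mul_le_mul_of_nonneg_right h2 (norm_nonneg d)]
  have := hanti (left_mem_Icc.2 zero_le_one) (right_mem_Icc.2 zero_le_one) zero_le_one
  simp only [one_smul, zero_smul, add_zero] at this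
  linarith

/-- The decrease of the kinetic energy along one step of INNA, together with the quadratic
upper bound on the increase of the potential energy. -/
theorem inna_energy_decrease {α β γ L c : ℝ}
    (hc₁ : c ≤ γ * (2 * β - γ))
    (hc₂ : c ≤ γ * (2 * α - γ * ((1 + α * β - γ * α) * L + α ^ 2))) (g w : E) :
    (1 + α * β - γ * α) * (2 * γ * ⟪g, w⟫ + γ ^ 2 * (L * ‖w‖ ^ 2))
      + ‖(w + β • g) - γ • (α • w + g)‖ ^ 2 + c * (‖g‖ ^ 2 + ‖w‖ ^ 2) ≤ ‖w + β • g‖ ^ 2 := by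
  have h1 : ‖(w + β • g) - γ • (α • w + g)‖ ^ 2
      = (1 - γ * α) ^ 2 * ‖w‖ ^ 2 + 2 * (1 - γ * α) * (β - γ) * ⟪g, w⟫
        + (β - γ) ^ 2 * ‖g‖ ^ 2 := by
    have : (w + β • g) - γ • (α • w + g) = (1 - γ * α) • w + (β - γ) • g := by module
    rw [this, norm_add_sq_real, norm_smul, norm_smul, inner_smul_left, inner_smul_right,
      real_inner_comm, mul_pow, mul_pow, Real.norm_eq_abs, Real.norm_eq_abs, sq_abs, sq_abs]
    simp only [conj_trivial]
    ring
  have h2 : ‖w + β • g‖ ^ 2 = ‖w‖ ^ 2 + 2 * β * ⟪g, w⟫ + β ^ 2 * ‖g‖ ^ 2 := by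
    rw [norm_add_sq_real, norm_smul, inner_smul_right, real_inner_comm, mul_pow,
      Real.norm_eq_abs, sq_abs]
    ring
  rw [h1, h2]
  nlinarith [mul_le_mul_of_nonneg_right hc₁ (sq_nonneg ‖g‖),
    mul_le_mul_of_nonneg_right hc₂ (sq_nonneg ‖w‖)]

/-- INNA in the coordinates given by the position `z.1` and the momentum `z.2`. -/
def innaMap (g : E → E) (α β γ : ℝ) (z : E × E) : E × E :=
  (z.1 + γ • (z.2 - β • g z.1), z.2 - γ • (α • (z.2 - β • g z.1) + g z.1))

theorem innaMap_antilipschitz {g : E → E} {α β γ L : ℝ} (hγ : 0 < γ) (hβ : 0 < β)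
    (hL₀ : 0 < L) (hL : ∀ x y, ‖g x - g y‖ ≤ L * ‖x - y‖) (hγβ : γ < β)
    (hκ : 0 < 1 - γ * α - γ * (β - γ) * L) :
    ∃ K : ℝ≥0, AntilipschitzWith K (innaMap g α β γ) := by
  set κ := 1 - γ * α - γ * (β - γ) * L with hκ_def
  have hδ : 0 < 1 - γ * α := by
    have : 0 ≤ γ * (β - γ) * L := by have := sub_pos.2 hγβ; positivity
    linarith
  set A := (1 - γ * α + γ) / κ
  have hA : 0 ≤ A := by positivity
  set B := (1 + (1 + γ * β * L) * A) / γ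
  have hB : 0 ≤ B := by positivity
  refine ⟨⟨max A B, hA.trans (le_max_left _ _)⟩, AntilipschitzWith.of_le_mul_dist fun z z' => ?_⟩
  change _ ≤ max A B * _
  rw [dist_eq_norm, dist_eq_norm]
  set D := innaMap g α β γ z - innaMap g α β γ z' with hD
  have hD1 : D.1 = (z.1 - z'.1) + γ • ((z.2 - z'.2) - β • (g z.1 - g z'.1)) := by
    simp only [hD, innaMap, Prod.fst_sub]
    module
  have hD2 : D.2 = (z.2 - z'.2)
      - γ • (α • ((z.2 - z'.2) - β • (g z.1 - g z'.1)) + (g z.1 - g z'.1)) := by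
    simp only [hD, innaMap, Prod.snd_sub]
    module
  have hgL := hL z.1 z'.1
  have hn1 : ‖D.1‖ ≤ ‖D‖ := norm_fst_le D
  have hn2 : ‖D.2‖ ≤ ‖D‖ := norm_snd_le D
  have h1 : (1 - γ * α) • (z.1 - z'.1)
      = (1 - γ * α) • D.1 - γ • D.2 + (γ * (β - γ)) • (g z.1 - g z'.1) := by
    rw [hD1, hD2]
    module
  have h2 : (1 - γ * α) * ‖z.1 - z'.1‖
      ≤ (1 - γ * α) * ‖D.1‖ + γ * ‖D.2‖ + γ * (β - γ) * ‖g z.1 - g z'.1‖ := by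
    have hb : 0 ≤ γ * (β - γ) := mul_nonneg hγ.le (sub_pos.2 hγβ).le
    have := congrArg norm h1
    rw [norm_smul, Real.norm_of_nonneg hδ.le] at this
    rw [this]
    refine (norm_add_le _ _).trans (add_le_add ((norm_sub_le _ _).trans ?_) ?_)
    · rw [norm_smul, norm_smul, Real.norm_of_nonneg hδ.le, Real.norm_of_nonneg hγ.le]
    · rw [norm_smul, Real.norm_of_nonneg hb]
  have h3 : ‖z.1 - z'.1‖ ≤ A * ‖D‖ := by
    rw [div_mul_eq_mul_div, le_div_iff₀ hκ]
    have hb : 0 ≤ γ * (β - γ) := mul_nonneg hγ.le (sub_pos.2 hγβ).le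
    nlinarith [mul_le_mul_of_nonneg_left hgL hb, mul_le_mul_of_nonneg_left hn1 hδ.le,
      mul_le_mul_of_nonneg_left hn2 hγ.le]
  have h4 : γ • (z.2 - z'.2) = D.1 - (z.1 - z'.1) + (γ * β) • (g z.1 - g z'.1) := by
    rw [hD1]
    module
  have h5 : γ * ‖z.2 - z'.2‖ ≤ ‖D.1‖ + ‖z.1 - z'.1‖ + γ * β * ‖g z.1 - g z'.1‖ := by
    have := congrArg norm h4
    rw [norm_smul, Real.norm_of_nonneg hγ.le] at this
    rw [this]
    refine (norm_add_le _ _).trans (add_le_add (norm_sub_le _ _) ?_)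
    rw [norm_smul, Real.norm_of_nonneg (by positivity)]
  have h6 : ‖z.2 - z'.2‖ ≤ B * ‖D‖ := by
    rw [div_mul_eq_mul_div, le_div_iff₀ hγ]
    have hb : 0 ≤ γ * β := by positivity
    nlinarith [mul_le_mul_of_nonneg_left hgL hb,
      mul_le_mul_of_nonneg_left h3 (show 0 ≤ 1 + γ * β * L by positivity)]
  rw [Prod.norm_def, Prod.fst_sub, Prod.snd_sub]
  exact max_le (h3.trans (mul_le_mul_of_nonneg_right (le_max_left _ _) (norm_nonneg _)))
    (h6.trans (mul_le_mul_of_nonneg_right (le_max_right _ _) (norm_nonneg _)))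

end Energy

/-- A sequence in a compact set whose steps tend to zero and along which `g` tends to zero
converges, provided the zeros of `g` are isolated. -/
theorem exists_tendsto_of_isolated_zeros_s9 {X Y : Type*} [MetricSpace X] [ProperSpace X]
    [NormedAddCommGroup Y] {g : X → Y} (hg : Continuous g)
    (hiso : ∀ p, g p = 0 → ∀ᶠ x in 𝓝[≠] p, g x ≠ 0) {x : ℕ → X} {K : Set X} (hK : IsCompact K)
    (hxK : ∀ k, x k ∈ K) (hstep : Tendsto (fun k => dist (x (k + 1)) (x k)) atTop (𝓝 0))
    (hgx : Tendsto (fun k => g (x k)) atTop (𝓝 0)) :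
    ∃ p, g p = 0 ∧ Tendsto x atTop (𝓝 p) := by
  have hcl : ∀ q, MapClusterPt q atTop x → g q = 0 := by
    intro q hq
    have h1 : MapClusterPt (g q) atTop (g ∘ x) := hq.continuousAt_comp hg.continuousAt
    have h2 : (𝓝 (g q) ⊓ 𝓝 0).NeBot := ClusterPt.mono h1 hgx
    exact eq_of_nhds_neBot h2
  obtain ⟨p, -, hp⟩ := hK.exists_mapClusterPt (f := atTop) (u := x)
    (le_principal_iff.2 (mem_map.2 (univ_mem' hxK)))
  refine ⟨p, hcl p hp, ?_⟩
  obtain ⟨r, hr, hr'⟩ :=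
    Metric.eventually_nhds_iff.1 (eventually_nhdsWithin_iff.1 (hiso p (hcl p hp)))
  rw [Metric.tendsto_atTop]
  intro ε hε
  set ρ := min ε (r / 2) with hρ
  have hρ0 : 0 < ρ := by positivity
  have hAc : IsCompact (closedBall p ρ \ ball p (ρ / 2)) :=
    (isCompact_closedBall p ρ).diff isOpen_ball
  have hA : ∀ᶠ k in atTop, x k ∉ closedBall p ρ \ ball p (ρ / 2) := by
    by_contra h
    obtain ⟨q, hqA, hq⟩ := hAc.exists_mapClusterPt_of_frequently (not_eventually.1 h |>.mono
      fun k hk => not_not.1 hk)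
    have hqr : dist q p < r := by
      have h1 : dist q p ≤ ρ := hqA.1
      have h2 : ρ ≤ r / 2 := min_le_right _ _
      linarith
    refine hr' hqr ?_ (hcl q hq)
    rintro rfl
    exact hqA.2 (mem_ball_self (by positivity))
  have hs : ∀ᶠ k in atTop, dist (x (k + 1)) (x k) < ρ / 2 :=
    hstep.eventually (gt_mem_nhds (by positivity))
  obtain ⟨N, hN⟩ := eventually_atTop.1 (hA.and hs)
  obtain ⟨M, hM, hMN⟩ := (mapClusterPt_iff_frequently.1 hp (ball p (ρ / 2))
    (ball_mem_nhds p (by positivity))).forall_exists_of_atTop N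
  have hind : ∀ k ≥ M, x k ∈ ball p (ρ / 2) := by
    intro k hk
    induction k, hk using Nat.le_induction with
    | base => exact hMN
    | succ k hk ih =>
      by_contra h
      refine (hN (k + 1) (by omega)).1 ⟨?_, h⟩
      have h1 := (hN k (by omega)).2
      have h2 : dist (x k) p < ρ / 2 := ih
      rw [mem_closedBall]
      linarith [dist_triangle (x (k + 1)) (x k) p]
  refine ⟨M, fun k hk => ?_⟩
  have h1 : dist (x k) p < ρ / 2 := hind k hk
  linarith [min_le_left ε (r / 2)]

/-- A quadratic form is strictly increased by every map close enough, in the Lipschitz sense,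
to a linear map that strictly increases it. -/
theorem exists_quadratic_increase {F : Type*} [NormedAddCommGroup F] [NormedSpace ℝ F]
    {f : F → F} {p : F} {A : F →L[ℝ] F}
    (hf : HasStrictFDerivAt f A p) (b : F →L[ℝ] F →L[ℝ] ℝ) {c : ℝ} (hc : 0 < c)
    (hb : ∀ z, b z z + c * ‖z‖ ^ 2 ≤ b (A z) (A z)) :
    ∃ r > 0, ∀ x ∈ closedBall p r, ∀ y ∈ closedBall p r,
      b (x - y) (x - y) + c / 2 * ‖x - y‖ ^ 2 ≤ b (f x - f y) (f x - f y) := by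
  have hb0 : 0 ≤ ‖b‖ := norm_nonneg b
  have hA0 : 0 ≤ ‖A‖ := norm_nonneg A
  obtain ⟨ε, hε, hε1, hεc⟩ : ∃ ε : ℝ, 0 < ε ∧ ε ≤ 1 ∧ ε * (‖b‖ * (2 * ‖A‖ + 1)) ≤ c / 2 := by
    refine ⟨min 1 (c / (2 * (‖b‖ * (2 * ‖A‖ + 1) + 1))), by positivity, min_le_left _ _, ?_⟩
    refine (mul_le_mul_of_nonneg_right (min_le_right _ _) (by positivity)).trans ?_
    rw [div_mul_eq_mul_div, div_le_iff₀ (by positivity)]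
    nlinarith
  have h1 := hf.isLittleO.bound hε
  rw [nhds_prod_eq, Metric.nhds_basis_closedBall.prod_self.eventually_iff] at h1
  obtain ⟨r, hr, h1⟩ := h1
  refine ⟨r, hr, fun x hx y hy => ?_⟩
  have h2 := h1 (show (x, y) ∈ _ from ⟨hx, hy⟩)
  simp only at h2
  set d := x - y
  obtain ⟨h, hh⟩ : ∃ h, f x - f y = A d + h := ⟨f x - f y - A d, by abel⟩
  rw [hh, add_sub_cancel_left] at h2
  rw [hh]
  simp only [map_add, add_apply]
  have e1 : |b (A d) h| ≤ ‖b‖ * (‖A‖ * ‖d‖) * (ε * ‖d‖) :=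
    (b.le_opNorm₂ _ _).trans (by gcongr; exact A.le_opNorm d)
  have e2 : |b h (A d)| ≤ ‖b‖ * (ε * ‖d‖) * (‖A‖ * ‖d‖) :=
    (b.le_opNorm₂ _ _).trans (by gcongr; exact A.le_opNorm d)
  have e3 : |b h h| ≤ ‖b‖ * (1 * ‖d‖) * (ε * ‖d‖) :=
    (b.le_opNorm₂ _ _).trans (by
      have : ‖h‖ ≤ 1 * ‖d‖ := h2.trans (by gcongr)
      gcongr)
  have e4 := mul_le_mul_of_nonneg_right hεc (sq_nonneg ‖d‖)
  nlinarith [hb d, (abs_le.1 e1).1, (abs_le.1 e2).1, (abs_le.1 e3).1]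

section Null

variable {F : Type*} [NormedAddCommGroup F] [NormedSpace ℝ F] [FiniteDimensional ℝ F]
  [MeasurableSpace F] [BorelSpace F] (μ : Measure F) [μ.IsAddHaarMeasure]

theorem AntilipschitzWith.addHaar_preimage_eq_zero {K : ℝ≥0} {f : F → F}
    (hf : AntilipschitzWith K f) {s : Set F} (hs : μ s = 0) : μ (f ⁻¹' s) = 0 := by
  have h1 : (Measure.hausdorffMeasure (Module.finrank ℝ F) : Measure F) s = 0 :=
    Measure.absolutelyContinuous_isAddHaarMeasure _ μ hs
  refine Measure.absolutelyContinuous_isAddHaarMeasure μ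
    (Measure.hausdorffMeasure (Module.finrank ℝ F)) ?_
  refine le_antisymm ((hf.hausdorffMeasure_preimage_le (Nat.cast_nonneg _) s).trans ?_) zero_le
  rw [h1, mul_zero]

/-- If the derivative of `f` at `p` strictly increases a quadratic form which is positive
somewhere, then the points whose whole orbit stays near `p` form a null set. -/
theorem exists_addHaar_orbit_closedBall_eq_zero {f : F → F} (hfc : Continuous f) {p : F}
    {A : F →L[ℝ] F} (hf : HasStrictFDerivAt f A p) (b : F →L[ℝ] F →L[ℝ] ℝ) {c : ℝ} (hc : 0 < c)
    (hb : ∀ z, b z z + c * ‖z‖ ^ 2 ≤ b (A z) (A z)) {e : F} (he : 0 < b e e) :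
    ∃ r > 0, μ {x | ∀ k, f^[k] x ∈ closedBall p r} = 0 := by
  obtain ⟨r, hr, hq⟩ := exists_quadratic_increase hf b hc hb
  refine ⟨r, hr, ?_⟩
  set W := {x | ∀ k, f^[k] x ∈ closedBall p r} with hW
  have hWm : MeasurableSet W := by
    have : W = ⋂ k, f^[k] ⁻¹' closedBall p r := by ext; simp [hW]
    rw [this]
    exact (isClosed_iInter fun k => isClosed_closedBall.preimage (hfc.iterate k)).measurableSet
  have hpos : ∀ x ∈ W, ∀ y ∈ W, b (x - y) (x - y) ≤ 0 := by
    intro x hx y hy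
    by_contra! h0
    set M := ‖b‖ + 1
    have hM : 0 < M := by positivity
    have hbM : ∀ z, b z z ≤ M * ‖z‖ ^ 2 := fun z => by
      have := (le_abs_self _).trans (b.le_opNorm₂ z z)
      nlinarith [sq_nonneg ‖z‖]
    set σ := 1 + c / 2 / M
    have hσ : 1 < σ := by
      have : 0 < c / 2 / M := by positivity
      linarith
    have hgrow : ∀ k : ℕ, σ ^ k * b (x - y) (x - y)
        ≤ b (f^[k] x - f^[k] y) (f^[k] x - f^[k] y) := by
      intro k
      induction k with
      | zero => simp
      | succ k ih =>
        have h1 := hq _ (hx k) _ (hy k)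
        rw [← Function.iterate_succ_apply' f, ← Function.iterate_succ_apply' f] at h1
        set q := b (f^[k] x - f^[k] y) (f^[k] x - f^[k] y)
        have h2 : c / 2 / M * q ≤ c / 2 * ‖f^[k] x - f^[k] y‖ ^ 2 := by
          rw [div_mul_eq_mul_div, div_le_iff₀ hM]
          nlinarith [hbM (f^[k] x - f^[k] y)]
        calc σ ^ (k + 1) * b (x - y) (x - y) = σ * (σ ^ k * b (x - y) (x - y)) := by ring
          _ ≤ σ * q := by gcongr
          _ = q + c / 2 / M * q := by ring
          _ ≤ _ := by linarith
    obtain ⟨k, hk⟩ := pow_unbounded_of_one_lt (M * (2 * r) ^ 2 / b (x - y) (x - y)) hσ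
    rw [div_lt_iff₀ h0] at hk
    have h1 : ‖f^[k] x - f^[k] y‖ ≤ 2 * r := by
      rw [← dist_eq_norm]
      have h2 : dist (f^[k] x) p ≤ r := hx k
      have h3 : dist (f^[k] y) p ≤ r := hy k
      linarith [dist_triangle_right (f^[k] x) (f^[k] y) p]
    have h2 := (hgrow k).trans (hbM _)
    have h3 : M * ‖f^[k] x - f^[k] y‖ ^ 2 ≤ M * (2 * r) ^ 2 := by gcongr
    linarith
  refine Measure.addHaar_eq_zero_of_disjoint_translates μ (s := W)
    (fun n : ℕ => (1 / ((n : ℝ) + 1)) • e) ?_ ?_ hWm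
  · refine (isBounded_closedBall (x := (0 : F)) (r := ‖e‖)).subset ?_
    rintro _ ⟨n, rfl⟩
    rw [mem_closedBall_zero_iff, norm_smul, Real.norm_of_nonneg (by positivity)]
    refine mul_le_of_le_one_left (norm_nonneg _) ?_
    rw [div_le_one (by positivity)]
    linarith [(Nat.cast_nonneg n : (0 : ℝ) ≤ n)]
  · intro n m hnm
    rw [Function.onFun, Set.disjoint_left]
    intro z hz hz'
    simp only [singleton_add, mem_image] at hz hz'
    obtain ⟨x, hx, rfl⟩ := hz
    obtain ⟨y, hy, hxy⟩ := hz'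
    set t : ℝ := 1 / ((m : ℝ) + 1) - 1 / ((n : ℝ) + 1) with ht
    have h1 : x - y = t • e := by
      rw [ht, sub_smul, sub_eq_sub_iff_add_eq_add, hxy, add_comm]
    have ht0 : t ≠ 0 := by
      intro h
      rw [ht, sub_eq_zero, one_div, one_div, inv_inj] at h
      exact hnm (by exact_mod_cast (add_right_cancel h).symm)
    have h2 := hpos x hx y hy
    rw [h1] at h2
    simp only [map_smul, smul_apply, smul_eq_mul] at h2
    have : 0 < t ^ 2 := by positivity
    nlinarith [mul_pos this he]

/-- If the derivative of an antilipschitz map `f` at `p` strictly increases a quadratic form which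
is positive somewhere, then the points whose orbit converges to `p` form a null set. -/
theorem addHaar_basin_eq_zero {f : F → F} (hfc : Continuous f) {K : ℝ≥0}
    (hfK : AntilipschitzWith K f) {p : F}
    {A : F →L[ℝ] F} (hf : HasStrictFDerivAt f A p) (b : F →L[ℝ] F →L[ℝ] ℝ) {c : ℝ} (hc : 0 < c)
    (hb : ∀ z, b z z + c * ‖z‖ ^ 2 ≤ b (A z) (A z)) {e : F} (he : 0 < b e e) :
    μ {x | Tendsto (fun k => f^[k] x) atTop (𝓝 p)} = 0 := by
  obtain ⟨r, hr, hW⟩ := exists_addHaar_orbit_closedBall_eq_zero μ hfc hf b hc hb he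
  have hpre : ∀ n : ℕ, μ (f^[n] ⁻¹' {x | ∀ k, f^[k] x ∈ closedBall p r}) = 0 := by
    intro n
    induction n with
    | zero => simpa using hW
    | succ n ih =>
      rw [Function.iterate_succ, preimage_comp]
      exact hfK.addHaar_preimage_eq_zero μ ih
  refine measure_mono_null ?_ (measure_iUnion_null hpre)
  intro x hx
  obtain ⟨N, hN⟩ := eventually_atTop.1 (hx.eventually (closedBall_mem_nhds p hr))
  refine mem_iUnion.2 ⟨N, fun k => ?_⟩
  rw [← Function.iterate_add_apply]
  exact hN _ (by omega)

end Null

section Critical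

variable {E : Type*} [NormedAddCommGroup E] [InnerProductSpace ℝ E]

theorem isLocalMin_of_hessian_coercive [CompleteSpace E] {J : E → ℝ} {g : E → E}
    (hg : ∀ x, HasGradientAt J (g x) x) {p : E} {H : E →L[ℝ] E} (hH : HasFDerivAt g H p)
    (hp : g p = 0) {c : ℝ} (hc : 0 < c) (hpos : ∀ x, c * ‖x‖ ^ 2 ≤ ⟪H x, x⟫) :
    IsLocalMin J p := by
  have h1 := hH.isLittleO.bound hc
  rw [Metric.eventually_nhds_iff_ball] at h1
  obtain ⟨r, hr, h1⟩ := h1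
  have h2 : ∀ x ∈ ball p r, 0 ≤ ⟪g x, x - p⟫ := by
    intro x hx
    have h3 := h1 x hx
    rw [hp, sub_zero] at h3
    have h4 := (abs_le.1 (abs_real_inner_le_norm (g x - H (x - p)) (x - p))).1
    rw [inner_sub_left] at h4
    nlinarith [hpos (x - p), mul_le_mul_of_nonneg_right h3 (norm_nonneg (x - p))]
  filter_upwards [ball_mem_nhds p hr] with x hx
  set d := x - p with hd
  have hder : ∀ t : ℝ, HasDerivAt (fun t : ℝ => J (p + t • d)) ⟪g (p + t • d), d⟫ t := by
    intro t
    have h1 : HasDerivAt (fun t : ℝ => p + t • d) d t := by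
      simpa using ((hasDerivAt_id t).smul_const d).const_add p
    exact (hg (p + t • d)).hasFDerivAt.comp_hasDerivAt t h1
  have hmono : MonotoneOn (fun t : ℝ => J (p + t • d)) (Icc 0 1) := by
    refine monotoneOn_of_deriv_nonneg (convex_Icc 0 1)
      (fun t _ => (hder t).continuousAt.continuousWithinAt)
      (fun t _ => (hder t).differentiableAt.differentiableWithinAt) fun t ht => ?_
    rw [interior_Icc] at ht
    rw [(hder t).deriv]
    have hmem : p + t • d ∈ ball p r := by
      rw [mem_ball_iff_norm] at hx ⊢
      rw [add_sub_cancel_left, norm_smul, Real.norm_of_nonneg ht.1.le]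
      exact (mul_le_of_le_one_left (norm_nonneg _) ht.2.le).trans_lt hx
    have h3 := h2 _ hmem
    rw [add_sub_cancel_left, inner_smul_right] at h3
    exact nonneg_of_mul_nonneg_right h3 ht.1
  have := hmono (left_mem_Icc.2 zero_le_one) (right_mem_Icc.2 zero_le_one) zero_le_one
  simpa [hd] using this

/-- A symmetric positive semidefinite operator which is bounded below is coercive. -/
theorem exists_coercive_of_antilipschitz {H : E →L[ℝ] E}
    (hsymm : ∀ x y, ⟪H x, y⟫ = ⟪x, H y⟫) (hpos : ∀ x, 0 ≤ ⟪H x, x⟫) {K : ℝ} (hK : 0 < K)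
    (hHK : ∀ x, ‖x‖ ≤ K * ‖H x‖) : ∃ c > 0, ∀ x, c * ‖x‖ ^ 2 ≤ ⟪H x, x⟫ := by
  set M := ‖H‖ + 1
  have hM : 0 < M := by positivity
  refine ⟨1 / (M * K ^ 2), by positivity, fun x => ?_⟩
  have h1 := hpos (M • x - H x)
  simp only [map_sub, map_smul, inner_sub_left, inner_sub_right, inner_smul_left,
    inner_smul_right, conj_trivial] at h1
  rw [hsymm (H x) x, real_inner_self_eq_norm_sq] at h1
  have h2 : ⟪H (H x), H x⟫ ≤ M * ‖H x‖ ^ 2 := by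
    have h3 := real_inner_le_norm (H (H x)) (H x)
    have h4 := H.le_opNorm (H x)
    nlinarith [mul_le_mul_of_nonneg_right h4 (norm_nonneg (H x)), sq_nonneg ‖H x‖]
  have h5 : ‖H x‖ ^ 2 ≤ M * ⟪H x, x⟫ := by
    refine le_of_mul_le_mul_left ?_ hM
    nlinarith
  have h6 : ‖x‖ ^ 2 ≤ K ^ 2 * ‖H x‖ ^ 2 := by
    rw [← mul_pow]
    gcongr
    exact hHK x
  rw [div_mul_eq_mul_div, one_mul, div_le_iff₀ (by positivity)]
  nlinarith [mul_le_mul_of_nonneg_left h5 (sq_nonneg K)]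

theorem contDiff_gradient [CompleteSpace E] {J : E → ℝ} (hJ : ContDiff ℝ 2 J) :
    ContDiff ℝ 1 (gradient J) := by
  have h1 : ContDiff ℝ 1 (fderiv ℝ J) := hJ.fderiv_right (by norm_num)
  have h2 : IsBoundedLinearMap ℝ (InnerProductSpace.toDual ℝ E).symm :=
    ⟨⟨map_add _, fun c x => by simp⟩, 1, one_pos, fun x => by simp⟩
  exact h2.contDiff.comp h1

theorem inner_fderiv_gradient_symm [CompleteSpace E] {J : E → ℝ} (hJ : ContDiff ℝ 2 J)
    (p x y : E) : ⟪fderiv ℝ (gradient J) p x, y⟫ = ⟪x, fderiv ℝ (gradient J) p y⟫ := by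
  have h1 : Differentiable ℝ (fderiv ℝ J) :=
    (hJ.fderiv_right (m := 1) (by norm_num)).differentiable (by norm_num)
  have h2 : Differentiable ℝ (gradient J) := (contDiff_gradient hJ).differentiable (by norm_num)
  have h3 : ∀ u w, fderiv ℝ (fderiv ℝ J) p u w = ⟪fderiv ℝ (gradient J) p u, w⟫ := by
    intro u w
    have h4 : HasFDerivAt (fun x => fderiv ℝ J x w) ((fderiv ℝ (fderiv ℝ J) p).flip w) p := by
      simpa using (h1 p).hasFDerivAt.clm_apply (hasFDerivAt_const w p)
    have h5 : HasFDerivAt (fun x => ⟪w, gradient J x⟫)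
        ((innerSL ℝ w).comp (fderiv ℝ (gradient J) p)) p :=
      (innerSL ℝ w).hasFDerivAt.comp p (h2 p).hasFDerivAt
    have h6 : (fun x => fderiv ℝ J x w) = fun x => ⟪w, gradient J x⟫ := by
      ext x
      rw [real_inner_comm, inner_gradient_left]
    rw [h6] at h4
    have h7 := DFunLike.congr_fun (h4.unique h5) u
    simpa [real_inner_comm] using h7
  have hs : IsSymmSndFDerivAt ℝ J p := hJ.contDiffAt.isSymmSndFDerivAt (by simp)
  rw [← h3, hs.eq x y, h3, real_inner_comm]

end Critical

section Dynamics

variable {E : Type*} [NormedAddCommGroup E] [InnerProductSpace ℝ E] [FiniteDimensional ℝ E]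

theorem exists_tendsto_innaMap {J : E → ℝ} {g : E → E}
    (hg : ∀ x, HasGradientAt J (g x) x) {L : ℝ} (hL : ∀ x y, ‖g x - g y‖ ≤ L * ‖x - y‖)
    (hgc : Continuous g) (hJ : Tendsto J (cocompact E) atTop)
    (hiso : ∀ p, g p = 0 → ∀ᶠ x in 𝓝[≠] p, g x ≠ 0) {α β γ c : ℝ} (hc : 0 < c)
    (hδ : 0 < 1 + α * β - γ * α) (hc₁ : c ≤ γ * (2 * β - γ))
    (hc₂ : c ≤ γ * (2 * α - γ * ((1 + α * β - γ * α) * L + α ^ 2))) (z : E × E) :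
    ∃ p, g p = 0 ∧ Tendsto (fun k => (innaMap g α β γ)^[k] z) atTop (𝓝 (p, 0)) := by
  set S := innaMap g α β γ
  set δ := 1 + α * β - γ * α with hδ_def
  have : ProperSpace E := FiniteDimensional.proper ℝ E
  have hJc : Continuous J := continuous_iff_continuousAt.2 fun x => (hg x).continuousAt
  obtain ⟨x₀, hx₀⟩ := hJc.exists_forall_le hJ
  set V : E × E → ℝ := fun z => 2 * δ * J z.1 + ‖z.2‖ ^ 2 with hV
  set w : E × E → E := fun z => z.2 - β • g z.1 with hw
  have hstep : ∀ z, V (S z) + c * (‖g z.1‖ ^ 2 + ‖w z‖ ^ 2) ≤ V z := by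
    intro z
    have h1 := HasGradientAt.le_add_inner_add_sq hg hL z.1 (γ • w z)
    have h2 := inna_energy_decrease hc₁ hc₂ (g z.1) (w z)
    rw [← hδ_def, show w z + β • g z.1 = z.2 by simp [hw]] at h2
    rw [inner_smul_right, norm_smul, mul_pow, Real.norm_eq_abs, sq_abs] at h1
    have h3 := mul_le_mul_of_nonneg_left h1 hδ.le
    change 2 * δ * J (z.1 + γ • w z) + ‖z.2 - γ • (α • w z + g z.1)‖ ^ 2 + _
      ≤ 2 * δ * J z.1 + ‖z.2‖ ^ 2
    nlinarith
  have hbdd : ∀ z, 2 * δ * J x₀ ≤ V z := fun z => by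
    have := mul_le_mul_of_nonneg_left (hx₀ z.1) hδ.le
    nlinarith [sq_nonneg ‖z.2‖]
  set D : ℕ → ℝ := fun k => V (S^[k] z) - V (S^[k + 1] z) with hD
  have hDle : ∀ k, c * (‖g (S^[k] z).1‖ ^ 2 + ‖w (S^[k] z)‖ ^ 2) ≤ D k := fun k => by
    have := hstep (S^[k] z)
    rw [← Function.iterate_succ_apply' S] at this
    simp only [hD]
    linarith
  have hanti : Antitone fun k => V (S^[k] z) := antitone_nat_of_succ_le fun k => by
    have h1 := hDle k
    have h2 : 0 ≤ c * (‖g (S^[k] z).1‖ ^ 2 + ‖w (S^[k] z)‖ ^ 2) := by positivity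
    simp only [hD] at h1
    linarith
  have hD0 : Tendsto D atTop (𝓝 0) := by
    have h1 := tendsto_atTop_ciInf hanti ⟨2 * δ * J x₀, by rintro _ ⟨k, rfl⟩; exact hbdd _⟩
    have h2 := h1.sub (h1.comp (tendsto_add_atTop_nat 1))
    rwa [sub_self] at h2
  have hsq : Tendsto (fun k => √(D k / c)) atTop (𝓝 0) := by
    simpa using (hD0.div_const c).sqrt
  have hg0 : Tendsto (fun k => g (S^[k] z).1) atTop (𝓝 0) :=
    squeeze_zero_norm (fun k => Real.le_sqrt_of_sq_le (by
      rw [le_div_iff₀ hc]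
      nlinarith [hDle k, mul_nonneg hc.le (sq_nonneg ‖w (S^[k] z)‖)])) hsq
  have hw0 : Tendsto (fun k => w (S^[k] z)) atTop (𝓝 0) :=
    squeeze_zero_norm (fun k => Real.le_sqrt_of_sq_le (by
      rw [le_div_iff₀ hc]
      nlinarith [hDle k, mul_nonneg hc.le (sq_nonneg ‖g (S^[k] z).1‖)])) hsq
  have hK : IsCompact {x | J x ≤ V z / (2 * δ)} := by
    obtain ⟨t, ht, hts⟩ := mem_cocompact.1 (hJ.eventually (eventually_gt_atTop (V z / (2 * δ))))
    refine ht.of_isClosed_subset (isClosed_le hJc continuous_const) fun x hx => ?_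
    by_contra hxt
    exact not_lt.2 (show J x ≤ _ from hx) (hts hxt)
  obtain ⟨p, hp, hlim⟩ := exists_tendsto_of_isolated_zeros_s9 (x := fun k => (S^[k] z).1)
    hgc hiso hK
    (fun k => by
      have h1 : V (S^[k] z) ≤ V z := hanti (Nat.zero_le k)
      change J _ ≤ _
      rw [le_div_iff₀ (by positivity)]
      have h2 : 2 * δ * J (S^[k] z).1 ≤ V (S^[k] z) := le_add_of_nonneg_right (by positivity)
      linarith)
    (by
      have h1 : ∀ k, dist (S^[k + 1] z).1 (S^[k] z).1 = ‖γ • w (S^[k] z)‖ := fun k => by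
        rw [Function.iterate_succ_apply' S, dist_eq_norm]
        congr 1
        exact add_sub_cancel_left _ _
      simp only [h1]
      simpa using (hw0.const_smul γ).norm)
    hg0
  refine ⟨p, hp, hlim.prodMk_nhds ?_⟩
  have h1 : ∀ k, (S^[k] z).2 = w (S^[k] z) + β • g (S^[k] z).1 := fun k => by simp [hw]
  simp only [h1]
  simpa using hw0.add (hg0.const_smul β)

/-- A strict saddle of `J` whose Hessian is nonsingular attracts only a null set. -/
theorem addHaar_basin_innaMap_eq_zero [MeasurableSpace E] [BorelSpace E] (μ : Measure (E × E))
    [μ.IsAddHaarMeasure] {g : E → E} {p : E} {H : E →L[ℝ] E} (hg : Continuous g)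
    (hH : HasStrictFDerivAt g H p) {L : ℝ} (hHL : ‖H‖ ≤ L)
    (hsymm : ∀ x y, ⟪H x, y⟫ = ⟪x, H y⟫) {M : ℝ}
    (hHM : ∀ x, ‖x‖ ≤ M * ‖H x‖) {e : E} (he : ⟪H e, e⟫ < 0) {α β γ c : ℝ} (hc : 0 < c)
    (hδ : 0 < 1 + α * β - γ * α) (hc₁ : c ≤ γ * (2 * β - γ))
    (hc₂ : c ≤ γ * (2 * α - γ * ((1 + α * β - γ * α) * L + α ^ 2))) {K : ℝ≥0}
    (hK : AntilipschitzWith K (innaMap g α β γ)) :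
    μ {z | Tendsto (fun k => (innaMap g α β γ)^[k] z) atTop (𝓝 (p, 0))} = 0 := by
  set δ := 1 + α * β - γ * α with hδ_def
  set G : E × E →L[ℝ] E := H ∘L ContinuousLinearMap.fst ℝ E E
  set w : E × E →L[ℝ] E := ContinuousLinearMap.snd ℝ E E - β • G
  set A : E × E →L[ℝ] E × E :=
    (ContinuousLinearMap.fst ℝ E E + γ • w).prod
      (ContinuousLinearMap.snd ℝ E E - γ • (α • w + G))
  have hS : HasStrictFDerivAt (innaMap g α β γ) A (p, 0) := by
    have h1 : HasStrictFDerivAt (fun z : E × E => g z.1) G (p, 0) :=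
      hH.comp (p, (0 : E)) hasStrictFDerivAt_fst
    have h2 : HasStrictFDerivAt (fun z : E × E => z.2 - β • g z.1) w (p, 0) :=
      hasStrictFDerivAt_snd.sub (h1.const_smul β)
    exact (hasStrictFDerivAt_fst.add (h2.const_smul γ)).prodMk
      (hasStrictFDerivAt_snd.sub (((h2.const_smul α).add h1).const_smul γ))
  have hSc : Continuous (innaMap g α β γ) := by
    unfold innaMap
    fun_prop
  set b : E × E →L[ℝ] E × E →L[ℝ] ℝ :=
    -(δ • (innerSL ℝ).bilinearComp G (ContinuousLinearMap.fst ℝ E E)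
      + (innerSL ℝ).bilinearComp (ContinuousLinearMap.snd ℝ E E) (ContinuousLinearMap.snd ℝ E E))
  have hb : ∀ z, b z z = -(δ * ⟪H z.1, z.1⟫ + ‖z.2‖ ^ 2) := fun z => by
    simp [b, G]
  set Q := M ^ 2 + 2 * β ^ 2 + 2
  have hQ : 0 < Q := by positivity
  refine addHaar_basin_eq_zero μ hSc hK (p := (p, 0)) (A := A) hS b (c := c / Q) (by positivity)
    (fun z => ?_) (e := (e, 0)) ?_
  · have h2 := inna_energy_decrease hc₁ hc₂ (H z.1) (w z)
    rw [← hδ_def, show w z + β • H z.1 = z.2 by simp [w, G]] at h2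
    have h3 : ⟪H (z.1 + γ • w z), z.1 + γ • w z⟫
        = ⟪H z.1, z.1⟫ + 2 * γ * ⟪H z.1, w z⟫ + γ ^ 2 * ⟪H (w z), w z⟫ := by
      simp only [map_add, map_smul, inner_add_left, inner_add_right, inner_smul_left,
        inner_smul_right, conj_trivial]
      rw [hsymm (w z) z.1, real_inner_comm (H z.1) (w z)]
      ring
    have h4 : ⟪H (w z), w z⟫ ≤ L * ‖w z‖ ^ 2 := by
      have h5 := real_inner_le_norm (H (w z)) (w z)
      have h6 := H.le_of_opNorm_le hHL (w z)
      nlinarith [mul_le_mul_of_nonneg_right h6 (norm_nonneg (w z))]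
    have h7 : ‖z‖ ^ 2 ≤ Q * (‖H z.1‖ ^ 2 + ‖w z‖ ^ 2) := by
      have h8 : ‖z.1‖ ^ 2 ≤ M ^ 2 * ‖H z.1‖ ^ 2 := by
        rw [← mul_pow]
        gcongr
        exact hHM z.1
      have h9 : ‖z.2‖ ^ 2 ≤ 2 * ‖w z‖ ^ 2 + 2 * β ^ 2 * ‖H z.1‖ ^ 2 := by
        have h10 : ‖z.2‖ ≤ ‖w z‖ + |β| * ‖H z.1‖ := by
          rw [show z.2 = w z + β • H z.1 by simp [w, G], ← Real.norm_eq_abs, ← norm_smul]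
          exact norm_add_le _ _
        have h11 : ‖z.2‖ ^ 2 ≤ (‖w z‖ + |β| * ‖H z.1‖) ^ 2 := by gcongr
        nlinarith [sq_nonneg (‖w z‖ - |β| * ‖H z.1‖), sq_abs β]
      have h12 : ‖z‖ ^ 2 ≤ ‖z.1‖ ^ 2 + ‖z.2‖ ^ 2 := by
        rw [Prod.norm_def]
        rcases max_choice ‖z.1‖ ‖z.2‖ with h | h <;> rw [h] <;>
          nlinarith [sq_nonneg ‖z.1‖, sq_nonneg ‖z.2‖]
      have h13 : 0 ≤ (M ^ 2 + 2 * β ^ 2) * ‖w z‖ ^ 2 := by positivity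
      simp only [Q]
      nlinarith [sq_nonneg ‖H z.1‖]
    have h14 : c / Q * ‖z‖ ^ 2 ≤ c * (‖H z.1‖ ^ 2 + ‖w z‖ ^ 2) := by
      rw [div_mul_eq_mul_div, div_le_iff₀ hQ]
      nlinarith [mul_le_mul_of_nonneg_left h7 hc.le]
    rw [hb, hb]
    change _ ≤ -(δ * ⟪H (z.1 + γ • w z), z.1 + γ • w z⟫ + ‖z.2 - γ • (α • w z + H z.1)‖ ^ 2)
    rw [h3]
    nlinarith [mul_le_mul_of_nonneg_left h4 (mul_nonneg hδ.le (sq_nonneg γ))]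
  · rw [hb]
    have := mul_pos hδ (neg_pos.2 he)
    simp only [norm_zero]
    linarith

end Dynamics

/-- The change of variables from `(θ, ψ)` to position and momentum. -/
noncomputable def momentumEquiv {E : Type*} [AddCommGroup E] [Module ℝ E] (a : ℝ) {β : ℝ}
    (hβ : β ≠ 0) : (E × E) ≃ₗ[ℝ] E × E where
  toFun q := (q.1, -a • q.1 - (1 / β) • q.2)
  invFun z := (z.1, -β • (z.2 + a • z.1))
  map_add' x y := by
    refine Prod.ext rfl ?_
    simp only [Prod.fst_add, Prod.snd_add]
    module
  map_smul' c x := by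
    refine Prod.ext rfl ?_
    simp only [Prod.smul_fst, Prod.smul_snd, RingHom.id_apply]
    module
  left_inv q := by
    refine Prod.ext rfl ?_
    simp only
    match_scalars <;> field_simp
    ring
  right_inv z := by
    refine Prod.ext rfl ?_
    simp only
    match_scalars <;> field_simp
    ring

theorem momentumEquiv_innaStep {P : ℕ} (J : EuclideanSpace ℝ (Fin P) → ℝ) (α γ : ℝ) {β : ℝ}
    (hβ : β ≠ 0) (q : EuclideanSpace ℝ (Fin P) × EuclideanSpace ℝ (Fin P)) :
    momentumEquiv (α - 1 / β) hβ (innaStep J α β γ q)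
      = innaMap (gradient J) α β γ (momentumEquiv (α - 1 / β) hβ q) := by
  refine Prod.ext rfl ?_
  simp only [momentumEquiv, innaStep, innaMap, LinearEquiv.coe_mk, LinearMap.coe_mk, AddHom.coe_mk]
  match_scalars <;> field_simp <;> ring

/-- Corollary 2 of the paper.
Let `J : ℝ^P → ℝ` be a twice continuously differentiable coercive Morse function with
`L`-Lipschitz gradient, `α > 0`, `β > 0`, and let the step-size `γ > 0` satisfy both
step-size conditions.  Then for every initialization the INNA `θ`-iterates converge,
and for every probability law on initial conditions that is absolutely continuous
with respect to the Lebesgue measure, almost surely the limit is a local minimizer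
of `J`. -/
theorem inna_converges_to_local_minima (P : ℕ) (J : EuclideanSpace ℝ (Fin P) → ℝ)
    (hJ : ContDiff ℝ 2 J)
    (hMorse : ∀ θs : EuclideanSpace ℝ (Fin P), gradient J θs = 0 →
      Function.Injective (fderiv ℝ (gradient J) θs))
    (hcoercive : Tendsto J (cocompact (EuclideanSpace ℝ (Fin P))) atTop)
    (L : ℝ) (hL : 0 < L) (hlip : LipschitzWith (Real.toNNReal L) (gradient J))
    (α β γ : ℝ) (hα : 0 < α) (hβ : 0 < β) (hγ : 0 < γ)
    (hγ₁ : γ < min (β / 2 + α / (2 * L) - Real.sqrt ((α + β * L) ^ 2 - 4 * L) / (2 * L)) β)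
    (hγ₂ : γ < min (2 * α / ((1 + α * β) * L + α ^ 2)) (min (1 / α + β) (2 * β))) :
    (∀ p : EuclideanSpace ℝ (Fin P) × EuclideanSpace ℝ (Fin P),
      ∃ θs : EuclideanSpace ℝ (Fin P),
        Tendsto (fun k => ((innaStep J α β γ)^[k] p).1) atTop (𝓝 θs)) ∧
    ∀ μ : Measure (EuclideanSpace ℝ (Fin P) × EuclideanSpace ℝ (Fin P)),
      IsProbabilityMeasure μ → μ ≪ volume →
      μ {p : EuclideanSpace ℝ (Fin P) × EuclideanSpace ℝ (Fin P) |
        ¬ ∃ θs : EuclideanSpace ℝ (Fin P),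
            Tendsto (fun k => ((innaStep J α β γ)^[k] p).1) atTop (𝓝 θs) ∧
            IsLocalMin J θs} = 0 := by
  have hg : ∀ x, HasGradientAt J (gradient J x) x := fun x =>
    (hJ.differentiable (by norm_num) x).hasGradientAt
  have hgd : ContDiff ℝ 1 (gradient J) := contDiff_gradient hJ
  have hgL : ∀ x y, ‖gradient J x - gradient J y‖ ≤ L * ‖x - y‖ := fun x y => by
    simpa [hL.le] using hlip.norm_sub_le x y
  have hHs : ∀ p, HasStrictFDerivAt (gradient J) (fderiv ℝ (gradient J) p) p := fun p =>
    hgd.contDiffAt.hasStrictFDerivAt (by norm_num)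
  have hHK : ∀ p, gradient J p = 0 → ∃ K : ℝ≥0, 0 < K ∧
      AntilipschitzWith K (fderiv ℝ (gradient J) p) := fun p hp =>
    LinearMap.exists_antilipschitzWith (fderiv ℝ (gradient J) p).toLinearMap
      (LinearMap.ker_eq_bot.2 (hMorse p hp))
  have hiso : ∀ p, gradient J p = 0 → ∀ᶠ x in 𝓝[≠] p, gradient J x ≠ 0 := fun p hp =>
    (hHs p).hasFDerivAt.eventually_ne ((hHK p hp).imp fun _ h => h.2)
  obtain ⟨hγ₁, hγβ⟩ := lt_min_iff.1 hγ₁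
  obtain ⟨hγ₂, hγ₃⟩ := lt_min_iff.1 hγ₂
  obtain ⟨hγ₃, hγ₄⟩ := lt_min_iff.1 hγ₃
  have hδ : 0 < 1 + α * β - γ * α := by
    have := mul_lt_mul_of_pos_right hγ₃ hα
    rw [add_mul, one_div, inv_mul_cancel₀ hα.ne'] at this
    linarith
  have hκ : 0 < 1 - γ * α - γ * (β - γ) * L := by
    have h1 : √((α + β * L) ^ 2 - 4 * L) < α + β * L - 2 * L * γ := by
      have h2 : β / 2 + α / (2 * L) - √((α + β * L) ^ 2 - 4 * L) / (2 * L)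
          = (α + β * L - √((α + β * L) ^ 2 - 4 * L)) / (2 * L) := by
        field_simp
        ring
      rw [h2, lt_div_iff₀ (by positivity)] at hγ₁
      linarith
    have h3 := (Real.sqrt_lt' ((Real.sqrt_nonneg _).trans_lt h1)).1 h1
    have h4 : 0 < 4 * L * (1 - γ * α - γ * (β - γ) * L) := by nlinarith
    exact pos_of_mul_pos_right h4 (by positivity)
  set c := min (γ * (2 * β - γ)) (γ * (2 * α - γ * ((1 + α * β - γ * α) * L + α ^ 2)))
  have hc : 0 < c := by
    refine lt_min (mul_pos hγ (by linarith)) (mul_pos hγ ?_)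
    rw [lt_div_iff₀ (by positivity)] at hγ₂
    have : 0 < γ * (γ * α * L) := by positivity
    linarith
  obtain ⟨K, hK⟩ := innaMap_antilipschitz hγ hβ hL hgL hγβ hκ
  set T := (momentumEquiv (E := EuclideanSpace ℝ (Fin P)) (α - 1 / β)
    hβ.ne').toContinuousLinearEquiv
  have hsemi : Function.Semiconj T (innaStep J α β γ) (innaMap (gradient J) α β γ) :=
    momentumEquiv_innaStep J α γ hβ.ne'
  have hconv : ∀ q, ∃ p, gradient J p = 0 ∧
      Tendsto (fun k => (innaMap (gradient J) α β γ)^[k] (T q)) atTop (𝓝 (p, 0)) := fun q =>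
    exists_tendsto_innaMap hg hgL hgd.continuous hcoercive hiso hc hδ (min_le_left _ _)
      (min_le_right _ _) (T q)
  have hfst : ∀ q p,
      Tendsto (fun k => (innaMap (gradient J) α β γ)^[k] (T q)) atTop (𝓝 (p, 0)) →
      Tendsto (fun k => ((innaStep J α β γ)^[k] q).1) atTop (𝓝 p) := fun q p h => by
    have h1 : ∀ k, ((innaStep J α β γ)^[k] q).1
        = ((innaMap (gradient J) α β γ)^[k] (T q)).1 := fun k => by
      rw [← (hsemi.iterate_right k).eq]
      rfl
    simp only [h1]
    exact (continuous_fst.tendsto (p, (0 : EuclideanSpace ℝ (Fin P)))).comp h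
  refine ⟨fun q => (hconv q).imp fun p h => hfst q p h.2, fun μ _ hμ => hμ ?_⟩
  set C : Set (EuclideanSpace ℝ (Fin P)) := {p | gradient J p = 0}
  have hCc : C.Countable := by
    have : DiscreteTopology C := discreteTopology_subtype_iff.2 fun p hp =>
      inf_principal_eq_bot.2 (hiso p hp)
    exact Set.countable_coe_iff.1 (countable_of_Lindelof_of_discrete (X := C))
  have : Measure.IsAddHaarMeasure
      (volume : Measure (EuclideanSpace ℝ (Fin P) × EuclideanSpace ℝ (Fin P))) :=
    Measure.prod.instIsAddHaarMeasure volume volume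
  have hnull : volume (⋃ p ∈ {p ∈ C | ¬ IsLocalMin J p},
      {z | Tendsto (fun k => (innaMap (gradient J) α β γ)^[k] z) atTop (𝓝 (p, 0))}) = 0 := by
    rw [measure_biUnion_null_iff (hCc.mono (sep_subset _ _))]
    rintro p ⟨hp, hmin⟩
    obtain ⟨M, hM, hMH⟩ := hHK p hp
    have hHM : ∀ x, ‖x‖ ≤ M * ‖fderiv ℝ (gradient J) p x‖ := fun x => by
      simpa using hMH.le_mul_dist x 0
    obtain ⟨e, he⟩ : ∃ e, ⟪fderiv ℝ (gradient J) p e, e⟫ < 0 := by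
      by_contra! hpos
      obtain ⟨c, hc, h⟩ := exists_coercive_of_antilipschitz (inner_fderiv_gradient_symm hJ p) hpos
        (NNReal.coe_pos.2 hM) hHM
      exact hmin (isLocalMin_of_hessian_coercive hg (hHs p).hasFDerivAt hp hc h)
    exact addHaar_basin_innaMap_eq_zero volume hgd.continuous (hHs p)
      (by simpa [hL.le] using norm_fderiv_le_of_lipschitz ℝ hlip (x₀ := p))
      (inner_fderiv_gradient_symm hJ p) hHM he hc hδ (min_le_left _ _) (min_le_right _ _) hK
  refine measure_mono_null ?_ (T.antilipschitz.addHaar_preimage_eq_zero volume hnull)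
  intro q hq
  obtain ⟨p, hp, hlim⟩ := hconv q
  exact mem_iUnion₂.2 ⟨p, ⟨hp, fun hmin => hq ⟨p, hfst q p hlim, hmin⟩⟩, hlim⟩
end
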